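/- In the Weyl group $W'_n$ of type $D_n$ with $n = 2c$ even, the $j$-induction of the sign representation from the naturally embedded reflection subgroup $W'_c \times W'_c$ equals the irreducible representation with symbol $[(2<3<4<\dots<c+1),(0<1<2<\dots<c-1)]$. -/

import Mathlib

open Finset Equiv

namespace CS

noncomputable section

/-- Inner product of class functions on a finite group. -/
def cinner {G : Type} [Group G] (φ ψ : G → ℂ) : ℂ :=
  (Nat.card G : ℂ)⁻¹ * ∑ᶠ g : G, φ g * ψ g⁻¹

/-- The character of the `d`-th symmetric power of a representation with character
`χ`, computed via Newton's recursion
`d·χ_{Sym^d}(g) = ∑_{k=1}^{d} χ(g^k) χ_{Sym^{d-k}}(g)`. -/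
def symChar {G : Type} [Group G] (χ : G → ℂ) : ℕ → G → ℂ
  | 0, _ => 1
  | (d+1), g => ((d : ℂ) + 1)⁻¹ *
      ∑ k ∈ Finset.range (d + 1), χ (g ^ (k + 1)) * symChar χ (d - k) g
  termination_by d _ => d
  decreasing_by omega

/-- Induction of class functions from a subgroup `H` to a subgroup `K` (of an ambient
group `G`), by the usual induced-character formula. -/
def indChar {G : Type} [Group G] (H K : Subgroup G) (φ : H → ℂ) : K → ℂ :=
  open scoped Classical in
  fun g => (Nat.card H : ℂ)⁻¹ *
    ∑ᶠ x : K, if h : ((x : G) * g * (x : G)⁻¹) ∈ H then φ ⟨_, h⟩ else 0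

/-- Restriction of a class function on the ambient group to a subgroup. -/
def resChar {G : Type} [Group G] (H : Subgroup G) (χ : G → ℂ) : H → ℂ :=
  fun h => χ h

/-- Restriction of a class function from a subgroup `K` to a subgroup `H` (junk value
`0` off `K`; meaningful when `H ≤ K`). -/
def resSub {G : Type} [Group G] (H K : Subgroup G) (χ : K → ℂ) : H → ℂ :=
  open scoped Classical in
  fun h => if hh : (h : G) ∈ K then χ ⟨_, hh⟩ else 0

/-- `χ` is the character of a (finite-dimensional, complex) representation. -/
def IsChar {G : Type} [Group G] (χ : G → ℂ) : Prop :=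
  ∃ (V : Type) (_ : AddCommGroup V) (_ : Module ℂ V) (ρ : Representation ℂ G V),
    FiniteDimensional ℂ V ∧ ∀ g, χ g = LinearMap.trace ℂ V (ρ g)

/-- `χ` is an irreducible character: a genuine character of norm one. -/
def IsIrrChar {G : Type} [Group G] (χ : G → ℂ) : Prop :=
  IsChar χ ∧ cinner χ χ = 1

/-- Multiplicity of `χE` in the `d`-th symmetric power of the reflection
representation (with character `χR`). -/
def bMult {G : Type} [Group G] (χR χE : G → ℂ) (d : ℕ) : ℂ :=
  cinner χE (symChar χR d)

/-- `b` is the `b`-invariant of `χE`: the least degree of the symmetric algebra of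
the reflection representation containing `χE`. -/
def IsBAt {G : Type} [Group G] (χR χE : G → ℂ) (b : ℕ) : Prop :=
  bMult χR χE b ≠ 0 ∧ ∀ d < b, bMult χR χE d = 0

/-- `χE = j_H^K (χE')` (GP 5.2.6): `χE` is an irreducible character of `K` occurring
in the induction of `χE'` from `H`, with the same `b`-invariant as `χE'`, where `χE'`
occurs with multiplicity one in the corresponding symmetric power for `H`; the
reflection characters of `H` and `K` are the restrictions of the ambient reflection
character `χR`. -/
def IsJInd {G : Type} [Group G] (χR : G → ℂ) (H K : Subgroup G)
    (χE' : H → ℂ) (χE : K → ℂ) : Prop :=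
  IsIrrChar χE ∧ cinner χE (indChar H K χE') ≠ 0 ∧
  ∃ b, IsBAt (resChar H χR) χE' b ∧ bMult (resChar H χR) χE' b = 1 ∧
    IsBAt (resChar K χR) χE b

/-! ### The hyperoctahedral group and its reflection subgroups.

We realize `W_n` (type `B_n/C_n`) as the permutations of `Fin n ⊕ Fin n`
(thought of as `{1,…,n} ⊔ {-1,…,-n}`) generated by the reflections below; `W'_n`
(type `D_n`) and the various reflection subgroups are likewise generated by the
appropriate reflections. -/

/-- Ambient permutation group of the `2n` points. -/
abbrev PG (n : ℕ) := Equiv.Perm (Fin n ⊕ Fin n)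

/-- The reflection-representation matrix of a signed permutation. -/
def Mrefl {n : ℕ} (π : PG n) : Matrix (Fin n) (Fin n) ℂ :=
  Matrix.of fun j i =>
    (if π (Sum.inl i) = Sum.inl j then 1 else 0) -
      (if π (Sum.inl i) = Sum.inr j then 1 else 0)

/-- The character of the reflection representation (on signed permutations). -/
def reflChar {n : ℕ} : PG n → ℂ := fun π => (Mrefl π).trace

/-- The sign (determinant) character of the reflection representation. -/
def sgnChar {n : ℕ} : PG n → ℂ := fun π => (Mrefl π).det

/-- The reflection `(e_i ↔ e_j)` (a double transposition). -/
def dsw {n : ℕ} (i j : Fin n) : PG n :=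
  Equiv.swap (Sum.inl i) (Sum.inl j) * Equiv.swap (Sum.inr i) (Sum.inr j)

/-- The reflection `e_i ↦ -e_i` (a sign change). -/
def ssw {n : ℕ} (i : Fin n) : PG n := Equiv.swap (Sum.inl i) (Sum.inr i)

/-- The reflection `e_i ↦ -e_j, e_j ↦ -e_i`. -/
def msw {n : ℕ} (i j : Fin n) : PG n :=
  Equiv.swap (Sum.inl i) (Sum.inr j) * Equiv.swap (Sum.inr i) (Sum.inl j)

/-- Types of blocks: symmetric group (`A`-type), hyperoctahedral (`B`-type),
even-signed (`D`-type). -/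
inductive BTy | S | B | D
deriving DecidableEq

/-- The reflection subgroup of `W_n` determined by a block structure: `f` assigns to
each index its block, `ty` the type of each index.  On an `S`-block only the
transpositions `dsw` act, on a `B`-block also the sign changes, on a `D`-block the
`dsw` and the `msw`.  (`W_{m₁} × … `-style products of reflection subgroups.) -/
def blkSub (n : ℕ) (f : Fin n → ℕ) (ty : Fin n → BTy) : Subgroup (PG n) :=
  Subgroup.closure
    ({π | ∃ i j, f i = f j ∧ π = dsw i j} ∪
     {π | ∃ i, ty i = BTy.B ∧ π = ssw i} ∪
     {π | ∃ i j, f i = f j ∧ ty i = BTy.D ∧ ty j = BTy.D ∧ π = msw i j})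

/-- The hyperoctahedral group `W_n` (Weyl group of type `B_n/C_n`). -/
def BWn (n : ℕ) : Subgroup (PG n) := blkSub n (fun _ => 0) (fun _ => BTy.B)

/-- The Weyl group `W'_n` of type `D_n` (the even elements of `W_n`). -/
def DWn (n : ℕ) : Subgroup (PG n) := blkSub n (fun _ => 0) (fun _ => BTy.D)

/-- The block of the index `i`, for blocks of consecutive sizes `c 0, c 1, …`
(`N` blocks in total). -/
def blockOf (N : ℕ) (c : ℕ → ℕ) (i : ℕ) : ℕ :=
  ((Finset.range N).filter fun b => ∑ b' ∈ Finset.range (b + 1), c b' ≤ i).card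

/-- The linear character of (a reflection subgroup of) `W_n` given by the product of
the signs of the coordinates in `T`. -/
def epsOn {n : ℕ} (T : Set (Fin n)) : PG n → ℂ :=
  open scoped Classical in
  fun π => ∏ᶠ i : Fin n, if i ∈ T ∧ (∃ j, π (Sum.inl i) = Sum.inr j) then -1 else 1

/-- The basic induced character of `W_n` attached to two sequences of (possibly
negative, in which case the character is `0`) block sizes: the character induced from
the product of the hyperoctahedral groups of the blocks, of the (trivial) ⊠ (product
of signs of coordinates) character, the second family of blocks carrying the
sign-of-coordinates character.  (These are the `h`-pieces of the Jacobi–Trudi-type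
formula for the irreducible characters of `W_n`.) -/
def indPiece (n r s : ℕ) (c : Fin r → ℤ) (d : Fin s → ℤ) : (BWn n) → ℂ :=
  open scoped Classical in
  if (∀ i, 0 ≤ c i) ∧ (∀ j, 0 ≤ d j) ∧ ((∑ i, c i) + ∑ j, d j) = (n : ℤ) then
    letI cs : ℕ → ℕ := fun b =>
      if hb : b < r then (c ⟨b, hb⟩).toNat
      else if hb' : b - r < s then (d ⟨b - r, hb'⟩).toNat else 0
    letI f : Fin n → ℕ := fun i => blockOf (r + s) cs (i : ℕ)
    indChar (blkSub n f (fun _ => BTy.B)) (BWn n)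
      (resChar _ (epsOn {i | r ≤ f i}))
  else 0

/-- The irreducible character of the hyperoctahedral group `W_n` attached to a
bipartition `(α, β)` (each written as a weakly decreasing integer vector), via the
Jacobi–Trudi-type determinantal formula
`χ_{(α,β)} = ∑_{σ,τ} sgn(σ)sgn(τ) · indPiece((αᵢ - i + σ(i))ᵢ, (βⱼ - j + τ(j))ⱼ)`. -/
def chiB (n r s : ℕ) (α : Fin r → ℤ) (β : Fin s → ℤ) : (BWn n) → ℂ :=
  fun w => ∑ᶠ σ : Equiv.Perm (Fin r), ∑ᶠ τ : Equiv.Perm (Fin s),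
    (((Equiv.Perm.sign σ : ℤ) * (Equiv.Perm.sign τ : ℤ) : ℤ) : ℂ) *
      indPiece n r s (fun i => α i - (i : ℕ) + ((σ i : ℕ) : ℤ))
        (fun j => β j - (j : ℕ) + ((τ j : ℕ) : ℤ)) w

/-- The irreducible character of `W_n` attached to a symbol
`[(λ₀ < … < λ_m), (μ₀ < … < μ_{m-1})]` (rows written as increasing sequences, with
`∑λ + ∑μ = m² + n`): subtract the staircases to get the bipartition. -/
def chiBSymbol (n m : ℕ) (row1 : Fin (m + 1) → ℕ) (row2 : Fin m → ℕ) : (BWn n) → ℂ :=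
  chiB n (m + 1) m
    (fun i => (row1 ⟨m - (i : ℕ), by have := i.isLt; omega⟩ : ℤ) - ((m - (i : ℕ) : ℕ) : ℤ))
    (fun j => (row2 ⟨m - 1 - (j : ℕ), by have := j.isLt; omega⟩ : ℤ) -
      ((m - 1 - (j : ℕ) : ℕ) : ℤ))

/-- The irreducible character of `W'_n` (type `D_n`) attached to a symbol
`[(λ₀ < … < λ_{m-1}), (μ₀ < … < μ_{m-1})]` with distinct rows (`∑λ + ∑μ = m² - m + n`):
the restriction to `W'_n` of the corresponding character of `W_n`. -/
def chiDSymbol (n m : ℕ) (row1 row2 : Fin m → ℕ) : (DWn n) → ℂ :=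
  resSub (DWn n) (BWn n)
    (chiB n m m
      (fun i => (row1 ⟨m - 1 - (i : ℕ), by have := i.isLt; omega⟩ : ℤ) -
        ((m - 1 - (i : ℕ) : ℕ) : ℤ))
      (fun j => (row2 ⟨m - 1 - (j : ℕ), by have := j.isLt; omega⟩ : ℤ) -
        ((m - 1 - (j : ℕ) : ℕ) : ℤ)))

/-- Two colorings with the same fiber sizes differ by a permutation. -/
theorem exists_perm_comp_eq {α κ : Type*} [Fintype α] [DecidableEq κ] (F F' : α → κ)
    (h : ∀ x, #{i | F i = x} = #{i | F' i = x}) : ∃ σ : Perm α, F' ∘ σ = F := by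
  have e : ∀ x, Nonempty ({i // F i = x} ≃ {i // F' i = x}) := fun x => by
    rw [← Fintype.card_eq, Fintype.card_subtype, Fintype.card_subtype, h]
  exact ⟨Equiv.ofFiberEquiv fun x => (e x).some,
    funext fun i => Equiv.ofFiberEquiv_map (fun x => (e x).some) i⟩

/-- Burnside's lemma for a finite stable set whose orbits are separated by an invariant. -/
theorem sum_card_fixed_eq {G α ι : Type*} [Group G] [Fintype G] [DecidableEq α] [DecidableEq ι]
    (act : G → α → α) (one_act : ∀ a, act 1 a = a)
    (mul_act : ∀ g h a, act (g * h) a = act g (act h a))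
    (Z : Finset α) (hZ : ∀ g, ∀ z ∈ Z, act g z ∈ Z) (inv : α → ι)
    (hinv : ∀ z ∈ Z, ∀ z' ∈ Z, inv z = inv z' ↔ ∃ g, act g z = z') :
    ∑ g : G, #{z ∈ Z | act g z = z} = #(Z.image inv) * Fintype.card G := by
  classical
  let : MulAction G Z :=
    { smul := fun g z => ⟨act g z, hZ g z z.2⟩
      one_smul := fun z => Subtype.ext (one_act z)
      mul_smul := fun g h z => Subtype.ext (mul_act g h z) }
  have key := MulAction.sum_card_fixedBy_eq_card_orbits_mul_card_group G Z
  have h1 : ∀ g : G, Fintype.card (MulAction.fixedBy Z g) = #{z ∈ Z | act g z = z} := by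
    intro g
    rw [← Fintype.card_coe]
    refine Fintype.card_congr
      { toFun := fun z => ⟨z.1.1, by
          simp only [mem_filter, Finset.coe_mem, true_and]
          exact congrArg Subtype.val z.2⟩
        invFun := fun z => ⟨⟨z.1, (mem_filter.1 z.2).1⟩, Subtype.ext (mem_filter.1 z.2).2⟩
        left_inv := fun z => rfl
        right_inv := fun z => rfl }
  simp_rw [h1] at key
  rw [key]
  congr 1
  rw [← Fintype.card_coe]
  refine Fintype.card_congr (Equiv.ofBijective
    (fun q => Quotient.liftOn' q
      (fun z : Z => (⟨inv z, mem_image_of_mem _ z.2⟩ : {x // x ∈ Z.image inv})) ?_) ⟨?_, ?_⟩)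
  · intro a b hab
    obtain ⟨g, hg⟩ := hab
    exact Subtype.ext (((hinv b b.2 a a.2).2 ⟨g, congrArg Subtype.val hg⟩).symm)
  · intro a b
    induction a using Quotient.inductionOn'
    induction b using Quotient.inductionOn'
    rename_i a b
    intro hab
    obtain ⟨g, hg⟩ := (hinv b b.2 a a.2).1 (congrArg Subtype.val hab).symm
    exact Quotient.sound' ⟨g, Subtype.ext hg⟩
  · rintro ⟨x, hx⟩
    obtain ⟨z, hz, rfl⟩ := mem_image.1 hx
    exact ⟨Quotient.mk'' ⟨z, hz⟩, rfl⟩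

open Equiv.Perm in
/-- The sign of a permutation in terms of its number of cycles. -/
theorem sign_eq_neg_one_pow_card_quotient {α : Type*} [Fintype α] [DecidableEq α] (σ : Perm α)
    [Fintype (Quotient (SameCycle.setoid σ))] :
    sign σ = (-1) ^ (Fintype.card α + Fintype.card (Quotient (SameCycle.setoid σ))) := by
  classical
  have hQ : Fintype.card (Quotient (SameCycle.setoid σ)) =
      Multiset.card σ.cycleType + (Fintype.card α - #σ.support) := by
    let φ : α → Perm α ⊕ α := fun i => if σ i = i then Sum.inr i else Sum.inl (σ.cycleOf i)
    have h1 : univ.image φ = σ.cycleFactorsFinset.disjSum σ.supportᶜ := by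
      ext x
      simp only [mem_image, mem_univ, true_and, mem_disjSum, φ]
      constructor
      · rintro ⟨i, rfl⟩
        split_ifs with h
        · exact Or.inr ⟨i, by simpa using h, rfl⟩
        · exact Or.inl ⟨_, by simpa [cycleOf_mem_cycleFactorsFinset_iff] using h, rfl⟩
      · rintro (⟨c, hc, rfl⟩ | ⟨i, hi, rfl⟩)
        · obtain ⟨i, hi⟩ := (mem_cycleFactorsFinset_iff.1 hc).1.nonempty_support
          refine ⟨i, ?_⟩
          rw [if_neg, cycle_is_cycleOf hi hc]
          exact mem_support.1 (mem_cycleFactorsFinset_support_le hc hi)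
        · exact ⟨i, if_pos (by simpa using hi)⟩
    have h2 : Fintype.card (Quotient (SameCycle.setoid σ)) = #(univ.image φ) := by
      rw [← Fintype.card_coe]
      have hφ : ∀ a b, SameCycle σ a b ↔ φ a = φ b := by
        intro a b
        simp only [φ]
        split_ifs with ha hb hb
        · simp only [Sum.inr.injEq]
          exact ⟨fun h => h.eq_of_left ha, fun h => h ▸ SameCycle.refl _ _⟩
        · simp only [iff_false]
          intro h
          have := h.eq_of_left ha
          exact hb (this ▸ ha)
        · simp only [iff_false]
          intro h
          have := h.eq_of_right hb
          exact ha (this ▸ hb)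
        · simp only [Sum.inl.injEq]
          constructor
          · exact fun h => h.cycleOf_eq
          · intro h
            have : a ∈ (σ.cycleOf b).support := by
              rw [← h, mem_support_cycleOf_iff]; exact ⟨SameCycle.refl _ _, mem_support.2 ha⟩
            exact (mem_support_cycleOf_iff.1 this).1.symm
      refine Fintype.card_congr (Equiv.ofBijective
        (fun q => Quotient.liftOn q (fun a => (⟨φ a, mem_image_of_mem _ (mem_univ _)⟩ :
          {x // x ∈ univ.image φ})) fun a b hab => Subtype.ext ((hφ a b).1 hab)) ⟨?_, ?_⟩)
      · intro a b
        induction a using Quotient.inductionOn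
        induction b using Quotient.inductionOn
        intro hab
        exact Quotient.sound ((hφ _ _).2 (congrArg Subtype.val hab))
      · rintro ⟨x, hx⟩
        obtain ⟨z, hz, rfl⟩ := mem_image.1 hx
        exact ⟨Quotient.mk _ z, rfl⟩
    rw [h2, h1, card_disjSum, card_compl, cycleType_def, Multiset.card_map]
    rfl
  have hs : #σ.support ≤ Fintype.card α := card_le_univ _
  rw [sign_of_cycleType, hQ, sum_cycleType]
  obtain ⟨k, hk⟩ := Nat.exists_eq_add_of_le hs
  rw [hk, Nat.add_sub_cancel_left,
    show #σ.support + k + (Multiset.card σ.cycleType + k) =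
      #σ.support + Multiset.card σ.cycleType + 2 * k by ring, pow_add _ _ (2 * k), pow_mul]
  simp

/-- Laplace expansion along a first column which is a unit vector. -/
theorem det_eq_of_col_zero_single {R : Type*} [CommRing R] {N : ℕ}
    (A : Matrix (Fin (N + 1)) (Fin (N + 1)) R) (r : Fin (N + 1))
    (h : ∀ i, A i 0 = if i = r then 1 else 0) :
    A.det = (-1) ^ (r : ℕ) * (A.submatrix r.succAbove Fin.succ).det := by
  rw [Matrix.det_succ_column_zero, Finset.sum_eq_single r]
  · simp [h]
  · intro b _ hb
    simp [h, hb]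
  · simp

theorem toeplitz_mul_toeplitz_eq_one {R : Type*} [CommRing R] (h e : ℤ → R)
    (h_neg : ∀ a < 0, h a = 0) (e_neg : ∀ a < 0, e a = 0)
    (conv : ∀ k : ℕ, ∑ i ∈ range (k + 1), h i * e ((k : ℤ) - i) = if k = 0 then 1 else 0) (N : ℕ) :
    (Matrix.of fun i j : Fin N => h ((j : ℤ) - (i : ℤ))) *
      (Matrix.of fun i j : Fin N => e ((j : ℤ) - (i : ℤ))) = 1 := by
  ext i j
  simp only [Matrix.mul_apply, Matrix.of_apply, Matrix.one_apply]
  rw [Fin.sum_univ_eq_sum_range (fun k => h ((k : ℤ) - (i : ℤ)) * e ((j : ℤ) - (k : ℤ))) N]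
  rcases lt_or_ge (j : ℕ) (i : ℕ) with hij | hij
  · rw [if_neg (by intro h0; subst h0; omega)]
    refine Finset.sum_eq_zero fun k _ => ?_
    rcases lt_or_ge k (i : ℕ) with hk | hk
    · rw [h_neg _ (by omega), zero_mul]
    · rw [e_neg _ (by omega), mul_zero]
  · obtain ⟨d, hd⟩ := Nat.exists_eq_add_of_le hij
    have hN := j.isLt
    have := conv d
    have h2 : (i = j) ↔ d = 0 := by rw [Fin.ext_iff]; omega
    simp only [h2]
    rw [← this]
    symm
    refine Finset.sum_of_injOn (fun k => k + (i : ℕ)) ?_ ?_ ?_ ?_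
    · intro a _ b _ hab
      simpa using hab
    · intro a ha
      simp only [coe_range, Set.mem_Iio] at ha ⊢
      omega
    · intro k hk hk'
      rcases lt_or_ge k (i : ℕ) with hk1 | hk1
      · rw [h_neg _ (by omega), zero_mul]
      · rw [e_neg _ ?_, mul_zero]
        by_contra hcon
        apply hk'
        refine ⟨k - i, ?_, ?_⟩
        · simp only [coe_range, Set.mem_Iio]
          omega
        · simp only
          omega
    · intro k _
      congr 2 <;> push_cast <;> omega

/-- Dual Jacobi–Trudi identity for the partition `(2^c)`. -/
theorem det_two_columns {R : Type*} [CommRing R] (h e : ℤ → R)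
    (h_neg : ∀ a < 0, h a = 0) (e_neg : ∀ a < 0, e a = 0) (h_zero : h 0 = 1)
    (conv : ∀ k : ℕ, ∑ i ∈ range (k + 1), h i * e ((k : ℤ) - i) = if k = 0 then 1 else 0) (c : ℕ) :
    (Matrix.of fun i j : Fin c => h (2 - (i : ℤ) + (j : ℤ))).det =
      e c * e c - e (c + 1) * e (c - 1) := by
  classical
  set T : Matrix (Fin (c + 2)) (Fin (c + 2)) R :=
    Matrix.of fun i j => h ((j : ℤ) - (i : ℤ)) with hT
  set T' : Matrix (Fin (c + 2)) (Fin (c + 2)) R :=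
    Matrix.of fun i j => e ((j : ℤ) - (i : ℤ)) with hT'
  have hTT : T * T' = 1 := toeplitz_mul_toeplitz_eq_one h e h_neg e_neg conv (c + 2)
  have detT : T.det = 1 := by
    rw [Matrix.det_of_isUpperTriangular]
    · simp [hT, h_zero]
    · intro i j hij
      simp only [id_eq] at hij
      simp only [hT, Matrix.of_apply]
      exact h_neg _ (by have : (j : ℕ) < i := hij; omega)
  let r : Fin (c + 2) → Fin (c + 2) := fun j =>
    if (j : ℕ) = 0 then ⟨c, by omega⟩ else ⟨c + 1, by omega⟩
  let X : Matrix (Fin (c + 2)) (Fin (c + 2)) R :=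
    Matrix.of fun i j => if (j : ℕ) < 2 then T' i (r j) else if i = j then 1 else 0
  have hTX : T * X = Matrix.of fun i (j : Fin (c + 2)) =>
      if (j : ℕ) < 2 then (if i = r j then 1 else 0) else T i j := by
    ext i j
    simp only [Matrix.mul_apply, X, Matrix.of_apply]
    split_ifs with h1 h2
    · have := congrFun (congrFun hTT i) (r j)
      rw [Matrix.mul_apply, Matrix.one_apply, if_pos h2] at this
      exact this
    · have := congrFun (congrFun hTT i) (r j)
      rw [Matrix.mul_apply, Matrix.one_apply, if_neg h2] at this
      exact this
    · simp
  have det1 : (T * X).det = (Matrix.of fun i j : Fin c => h (2 - (i : ℤ) + (j : ℤ))).det := by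
    rw [hTX, det_eq_of_col_zero_single _ ⟨c, by omega⟩, det_eq_of_col_zero_single _ (Fin.last c),
      ← mul_assoc, ← pow_add]
    · have : (-1 : R) ^ (c + c) = 1 := by rw [← two_mul, pow_mul]; simp
      simp only [Fin.val_last, this, one_mul]
      congr 1
      ext i j
      simp only [Matrix.submatrix_apply, Matrix.of_apply, Fin.val_succ, Fin.succAbove_last]
      rw [if_neg (by omega), Fin.succAbove_of_castSucc_lt _ _ (by
        rw [Fin.lt_def]; simp)]
      simp only [hT, Matrix.of_apply, Fin.val_succ, Fin.val_castSucc]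
      congr 1
      push_cast
      ring
    · intro i
      have hi := i.isLt
      rw [Matrix.submatrix_apply, Matrix.of_apply, if_pos (by simp)]
      have : Fin.succAbove (⟨c, by omega⟩ : Fin (c + 2)) i = r (Fin.succ 0) ↔ i = Fin.last c := by
        have h0 : r (Fin.succ 0) = ⟨c + 1, by omega⟩ := if_neg (by simp)
        have h1 : ((Fin.last c : Fin (c + 1)) : ℕ) = c := rfl
        rw [h0, Fin.ext_iff, Fin.ext_iff, h1]
        rcases lt_or_ge (i : ℕ) c with h2 | h2
        · rw [Fin.succAbove_of_castSucc_lt _ _ h2, Fin.val_castSucc]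
          simp only
          omega
        · rw [Fin.succAbove_of_le_castSucc _ _ h2, Fin.val_succ]
          simp only
          omega
      simp only [this]
    · intro i
      simp [r]
  have det2 : X.det = e c * e c - e (c + 1) * e (c - 1) := by
    let q : Fin 2 ⊕ Fin c ≃ Fin (c + 2) := finSumFinEquiv.trans (finCongr (add_comm 2 c))
    have hql : ∀ i, ((q (Sum.inl i) : Fin (c + 2)) : ℕ) = i := fun i => by simp [q]
    have hqr : ∀ i, ((q (Sum.inr i) : Fin (c + 2)) : ℕ) = 2 + i := fun i => by simp [q, add_comm]
    rw [← Matrix.det_submatrix_equiv_self q]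
    have : X.submatrix q q = Matrix.fromBlocks
        (Matrix.of fun i j : Fin 2 => e ((if (j : ℕ) = 0 then c else c + 1 : ℤ) - (i : ℤ))) 0
        (Matrix.of fun (i : Fin c) (j : Fin 2) => X (q (Sum.inr i)) (q (Sum.inl j))) 1 := by
      ext i j
      rcases i with i | i <;> rcases j with j | j
      · simp only [Matrix.submatrix_apply, X, Matrix.of_apply, hql, hT', r,
          Matrix.fromBlocks_apply₁₁]
        rw [if_pos j.isLt]
        congr 2
        split_ifs <;> simp
      · simp only [Matrix.submatrix_apply, X, Matrix.of_apply, hqr, Matrix.fromBlocks_apply₁₂]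
        rw [if_neg (by omega), if_neg (by simp)]
        rfl
      · rfl
      · simp only [Matrix.submatrix_apply, X, Matrix.of_apply, hqr, Matrix.fromBlocks_apply₂₂]
        rw [if_neg (by omega)]
        simp [Matrix.one_apply]
    rw [this, Matrix.det_fromBlocks_zero₁₂, Matrix.det_one, mul_one, Matrix.det_fin_two]
    simp
  rw [← det1, Matrix.det_mul, detT, det2, one_mul]

section
variable {Q : Type*} [Fintype Q] [DecidableEq Q]

/-- The degree `a` part (for weights `l`) of `∏ q, (1 + v X_q)`. -/
def pieceSum (l : Q → ℕ) (v : ℤ) (a : ℤ) : MvPolynomial Q ℤ :=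
  ∑ J : Finset Q with ∑ q ∈ J, (l q : ℤ) = a, ∏ q ∈ J, (MvPolynomial.C v * MvPolynomial.X q)

/-- The exponent vector of the product of all variables. -/
def allOnes (Q : Type*) [Fintype Q] : Q →₀ ℕ := Finsupp.equivFunOnFinite.symm 1

theorem coeff_allOnes_prod_pieceSum {β : Type*} [Fintype β] [DecidableEq β] (l : Q → ℕ) (v : ℤ)
    (k : β → ℤ) :
    MvPolynomial.coeff (allOnes Q) (∏ b, pieceSum l v (k b)) =
      v ^ Fintype.card Q * #{g : Q → β | ∀ b, ∑ q with g q = b, (l q : ℤ) = k b} := by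
  have hmono : ∀ J : β → Finset Q,
      ∏ b, ∏ q ∈ J b, (MvPolynomial.C v * MvPolynomial.X q : MvPolynomial Q ℤ) =
        MvPolynomial.monomial (Finsupp.equivFunOnFinite.symm fun q => #{b | q ∈ J b})
          (v ^ ∑ q, #{b | q ∈ J b}) := by
    intro J
    have h1 : ∀ b, ∏ q ∈ J b, (MvPolynomial.C v * MvPolynomial.X q : MvPolynomial Q ℤ) =
        ∏ q, if q ∈ J b then (MvPolynomial.C v * MvPolynomial.X q) else 1 := by
      intro b
      rw [Finset.prod_ite_mem, Finset.univ_inter]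
    simp_rw [h1]
    rw [Finset.prod_comm]
    have h2 : ∀ q, ∏ b, (if q ∈ J b then (MvPolynomial.C v * MvPolynomial.X q) else 1 :
        MvPolynomial Q ℤ) = MvPolynomial.C (v ^ #{b | q ∈ J b}) *
          MvPolynomial.X q ^ #{b | q ∈ J b} := by
      intro q
      rw [Finset.prod_ite, Finset.prod_const_one, mul_one, Finset.prod_const, mul_pow, map_pow]
    simp_rw [h2]
    rw [Finset.prod_mul_distrib, ← map_prod, Finset.prod_pow_eq_pow_sum, MvPolynomial.monomial_eq,
      Finsupp.prod_fintype _ _ (by simp)]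
    rfl
  unfold pieceSum
  rw [Finset.prod_univ_sum, MvPolynomial.coeff_sum]
  simp_rw [hmono, MvPolynomial.coeff_monomial]
  rw [← Finset.sum_filter]
  have hone : ∀ J : β → Finset Q,
      (Finsupp.equivFunOnFinite.symm fun q => #{b | q ∈ J b}) = allOnes Q ↔
        ∀ q, #{b | q ∈ J b} = 1 := by
    intro J
    rw [allOnes, EmbeddingLike.apply_eq_iff_eq, funext_iff]
    rfl
  have hconst : ∀ J ∈ (Fintype.piFinset fun b => ({J : Finset Q | ∑ q ∈ J, (l q : ℤ) = k b} :
      Finset (Finset Q))).filter (fun J => (Finsupp.equivFunOnFinite.symm fun q =>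
        #{b | q ∈ J b}) = allOnes Q),
      v ^ ∑ q, #{b | q ∈ J b} = v ^ Fintype.card Q := by
    intro J hJ
    simp [(hone J).1 (mem_filter.1 hJ).2]
  rw [Finset.sum_congr rfl hconst, Finset.sum_const, nsmul_eq_mul, mul_comm]
  congr 2
  symm
  refine Finset.card_bij (fun g _ b => {q | g q = b}) ?_ ?_ ?_
  · intro g hg
    simp only [mem_filter, mem_univ, true_and, Fintype.mem_piFinset, hone] at hg ⊢
    refine ⟨hg, fun q => ?_⟩
    simp [Finset.filter_eq]
  · intro g _ g' _ h
    funext q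
    have h1 := Finset.ext_iff.1 (congrFun h (g q)) q
    simpa [eq_comm] using h1
  · intro J hJ
    simp only [mem_filter, Fintype.mem_piFinset, hone, mem_univ, true_and] at hJ
    obtain ⟨hJ1, hJ2⟩ := hJ
    choose g hg using fun q => card_eq_one.1 (hJ2 q)
    have hgJ : ∀ q b, g q = b ↔ q ∈ J b := by
      intro q b
      have := Finset.ext_iff.1 (hg q) b
      simp only [mem_filter, mem_univ, true_and, mem_singleton] at this
      rw [this]
      exact eq_comm
    have hfJ : ∀ b, ({q | g q = b} : Finset Q) = J b := by
      intro b
      ext q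
      simp [hgJ]
    refine ⟨g, ?_, funext hfJ⟩
    simp only [mem_filter, mem_univ, true_and]
    intro b
    rw [hfJ]
    exact hJ1 b

/-- The ideal generated by the squares of the variables. -/
def squaresIdeal (Q : Type*) : Ideal (MvPolynomial Q ℤ) :=
  Ideal.span (Set.range fun q => MvPolynomial.X q ^ 2)

theorem coeff_allOnes_eq_zero (P : MvPolynomial Q ℤ) (hP : P ∈ squaresIdeal Q) :
    MvPolynomial.coeff (allOnes Q) P = 0 := by
  unfold squaresIdeal at hP
  induction hP using Submodule.span_induction with
  | mem x hx =>
    obtain ⟨q, rfl⟩ := hx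
    simp only [MvPolynomial.coeff_X_pow]
    rw [if_neg]
    intro h
    have := DFunLike.congr_fun h q
    simp [allOnes] at this
  | zero => simp
  | add x y _ _ hx hy => rw [MvPolynomial.coeff_add, hx, hy, add_zero]
  | smul a x hx ih =>
    clear ih
    induction hx using Submodule.span_induction generalizing a with
    | mem x hx =>
      obtain ⟨q, rfl⟩ := hx
      simp only [smul_eq_mul]
      rw [MvPolynomial.X_pow_eq_monomial, MvPolynomial.coeff_mul_monomial', if_neg]
      intro h
      have := h q
      simp [allOnes] at this
    | zero => simp
    | add x y _ _ hx hy => rw [smul_add, MvPolynomial.coeff_add, hx, hy, add_zero]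
    | smul b x _ ih => rw [smul_smul]; exact ih _

/-- The class of `pieceSum` modulo squares. -/
def pieceQuot (l : Q → ℕ) (v a : ℤ) : MvPolynomial Q ℤ ⧸ squaresIdeal Q :=
  Ideal.Quotient.mk _ (pieceSum l v a)

theorem pieceSum_neg (l : Q → ℕ) (v a : ℤ) (ha : a < 0) : pieceSum l v a = 0 := by
  unfold pieceSum
  rw [Finset.sum_eq_zero]
  intro J hJ
  have h1 := (mem_filter.1 hJ).2
  have : 0 ≤ ∑ q ∈ J, (l q : ℤ) := Finset.sum_nonneg fun _ _ => by positivity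
  omega

omit [DecidableEq Q] in
theorem pieceSum_zero (l : Q → ℕ) (hl : ∀ q, 0 < l q) (v : ℤ) : pieceSum l v 0 = 1 := by
  unfold pieceSum
  rw [Finset.sum_eq_single_of_mem ∅ (by simp)]
  · simp
  · intro J hJ hne
    exfalso
    have h1 := (mem_filter.1 hJ).2
    obtain ⟨q, hq⟩ := Finset.nonempty_iff_ne_empty.2 hne
    have : 0 < ∑ q ∈ J, (l q : ℤ) :=
      Finset.sum_pos (fun q _ => by exact_mod_cast hl q) ⟨q, hq⟩
    omega

omit [DecidableEq Q] in
theorem coeff_prod_one_add {R : Type*} [CommRing R] (y : Q → R) (l : Q → ℕ) (a : ℕ) :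
    (∏ q, (1 + Polynomial.C (y q) * Polynomial.X ^ l q)).coeff a =
      ∑ J : Finset Q with ∑ q ∈ J, (l q : ℤ) = a, ∏ q ∈ J, y q := by
  rw [Finset.prod_one_add, Polynomial.finsetSum_coeff, Finset.powerset_univ, Finset.sum_filter]
  refine Finset.sum_congr rfl fun J _ => ?_
  rw [Finset.prod_mul_distrib, Finset.prod_pow_eq_pow_sum, ← map_prod,
    Polynomial.coeff_C_mul_X_pow]
  have : (a = ∑ q ∈ J, l q) ↔ ∑ q ∈ J, (l q : ℤ) = a := by
    rw [← Nat.cast_sum, Nat.cast_inj, eq_comm]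
  simp only [this]

omit [DecidableEq Q] in
theorem pieceQuot_conv (l : Q → ℕ) (k : ℕ) :
    ∑ i ∈ range (k + 1), pieceQuot l 1 i * pieceQuot l (-1) ((k : ℤ) - i) =
      if k = 0 then 1 else 0 := by
  let y : ℤ → Q → MvPolynomial Q ℤ ⧸ squaresIdeal Q := fun v q =>
    Ideal.Quotient.mk _ (MvPolynomial.C v * MvPolynomial.X q)
  let P : ℤ → Polynomial (MvPolynomial Q ℤ ⧸ squaresIdeal Q) := fun v =>
    ∏ q, (1 + Polynomial.C (y v q) * Polynomial.X ^ l q)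
  have hP : ∀ v (a : ℕ), (P v).coeff a = pieceQuot l v a := by
    intro v a
    simp only [P, pieceQuot, pieceSum, coeff_prod_one_add, y, map_sum, map_prod]
  have h1 : P 1 * P (-1) = 1 := by
    simp only [P]
    rw [← Finset.prod_mul_distrib]
    refine Finset.prod_eq_one fun q _ => ?_
    have hy : y (-1) q = - y 1 q := by simp only [y, map_neg, map_one, neg_one_mul, one_mul]
    have hy2 : y 1 q * y 1 q = 0 := by
      simp only [y, map_one, one_mul]
      rw [← map_mul, Ideal.Quotient.eq_zero_iff_mem, ← pow_two]
      exact Ideal.subset_span ⟨q, rfl⟩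
    rw [hy, Polynomial.C_neg]
    have : (Polynomial.C (y 1 q)) * (Polynomial.C (y 1 q)) = 0 := by
      rw [← Polynomial.C_mul, hy2, Polynomial.C_0]
    linear_combination (-(Polynomial.X ^ l q * Polynomial.X ^ l q)) * this
  have h2 := congrArg (fun p => Polynomial.coeff p k) h1
  simp only [Polynomial.coeff_mul, Polynomial.coeff_one,
    Finset.Nat.sum_antidiagonal_eq_sum_range_succ_mk, hP] at h2
  rw [← h2]
  refine Finset.sum_congr rfl fun i hi => ?_
  rw [Nat.cast_sub (by have := mem_range.1 hi; omega)]

/-- The Jacobi–Trudi determinant of coloring counts for `(2^c)`. -/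
theorem sum_sign_mul_card_colorings (l : Q → ℕ) (hl : ∀ q, 0 < l q) (c : ℕ) :
    ∑ σ : Perm (Fin c), (Perm.sign σ : ℤ) *
        (#{g : Q → Fin c | ∀ b, ∑ q with g q = b, (l q : ℤ) = 2 - (b : ℤ) + (σ b : ℕ)} : ℤ) =
      (-1) ^ Fintype.card Q *
        ((#{g : Q → Bool | ∀ b, ∑ q with g q = b, (l q : ℤ) = c} : ℤ) -
          #{g : Q → Bool | ∀ b, ∑ q with g q = b, (l q : ℤ) =
            bif b then (c : ℤ) - 1 else c + 1}) := by
  have hdet := det_two_columns (pieceQuot l 1) (pieceQuot l (-1))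
    (fun a ha => by rw [pieceQuot, pieceSum_neg l _ a ha, map_zero])
    (fun a ha => by rw [pieceQuot, pieceSum_neg l _ a ha, map_zero])
    (by rw [pieceQuot, pieceSum_zero l hl, map_one]) (pieceQuot_conv l) c
  rw [← Matrix.det_transpose, Matrix.det_apply'] at hdet
  simp only [Matrix.transpose_apply, Matrix.of_apply, pieceQuot, ← map_prod, ← map_mul,
    ← map_sub] at hdet
  have hs : ∀ σ : Perm (Fin c), (((Perm.sign σ : ℤˣ) : ℤ) : MvPolynomial Q ℤ ⧸ squaresIdeal Q) =
    Ideal.Quotient.mk _ (MvPolynomial.C ((Perm.sign σ : ℤˣ) : ℤ)) := by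
    intro σ
    simp
  simp only [hs, ← map_mul, ← map_sum] at hdet
  rw [Ideal.Quotient.eq] at hdet
  have h0 := coeff_allOnes_eq_zero _ hdet
  rw [MvPolynomial.coeff_sub, MvPolynomial.coeff_sub, sub_eq_zero, MvPolynomial.coeff_sum] at h0
  simp only [MvPolynomial.coeff_C_mul] at h0
  have e1 : pieceSum l (-1) c * pieceSum l (-1) c =
      ∏ b : Bool, pieceSum l (-1) ((fun _ => (c : ℤ)) b) := by simp [sq]
  have e2 : pieceSum l (-1) (c + 1) * pieceSum l (-1) (c - 1) =
      ∏ b : Bool, pieceSum l (-1) ((fun b : Bool => (bif b then (c : ℤ) - 1 else c + 1)) b) := by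
    simp [mul_comm]
  rw [e1, e2, coeff_allOnes_prod_pieceSum, coeff_allOnes_prod_pieceSum] at h0
  rw [mul_sub]
  refine Eq.trans ?_ (h0.trans (by congr!))
  refine Finset.sum_congr rfl fun σ _ => ?_
  rw [coeff_allOnes_prod_pieceSum l 1 (fun b : Fin c => 2 - (b : ℤ) + (σ b : ℕ)), one_pow, one_mul]
  congr!

end

/-- The number of points of color `true`. -/
def trueCard {n : ℕ} (A : Fin n → Bool) : ℕ := #{i | A i = true}

/-- The subsets of size `c`. -/
def level (n c : ℕ) : Finset (Fin n → Bool) := {A | trueCard A = c}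

/-- The subsets of size `c - 1` (none if `c = 0`). -/
def levelPred (n c : ℕ) : Finset (Fin n → Bool) := {A | trueCard A + 1 = c}

/-- The number of members of `S` fixed by `σ`. -/
def fixCount {n : ℕ} (S : Finset (Fin n → Bool)) (σ : Perm (Fin n)) : ℕ := #{A ∈ S | A ∘ σ = A}

theorem comp_eq_iff_sameCycle {α β : Type*} (σ : Perm α) (g : α → β) :
    g ∘ σ = g ↔ ∀ i j, σ.SameCycle i j → g i = g j := by
  constructor
  · rintro h i j ⟨k, rfl⟩
    have h1 : ∀ x, g (σ x) = g x := fun x => congrFun h x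
    have h2 : ∀ x, g (σ⁻¹ x) = g x := fun x => by
      simpa using (h1 (σ⁻¹ x)).symm
    symm
    induction k with
    | zero => simp
    | succ k ih => rw [add_comm, zpow_add, zpow_one, Perm.mul_apply, h1]; exact ih
    | pred k ih =>
      rw [sub_eq_add_neg, add_comm, zpow_add, zpow_neg_one, Perm.mul_apply, h2]
      exact ih
  · intro h
    funext i
    exact (h i (σ i) ⟨1, by simp⟩).symm

open Classical in
theorem card_colorings_quotient {α β : Type*} [Fintype α] [Fintype β]
    (σ : Perm α) (k : β → ℤ) :
    #{g : Quotient (Perm.SameCycle.setoid σ) → β | ∀ b, ∑ q with g q = b,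
        ((#{i : α | (Quotient.mk _ i : Quotient (Perm.SameCycle.setoid σ)) = q} : ℕ) : ℤ) = k b} =
      #{g : α → β | g ∘ σ = g ∧ ∀ b, (#{i | g i = b} : ℤ) = k b} := by
  have hsum : ∀ (g : Quotient (Perm.SameCycle.setoid σ) → β) (b : β), ∑ q with g q = b,
      ((#{i : α | (Quotient.mk _ i : Quotient (Perm.SameCycle.setoid σ)) = q} : ℕ) : ℤ) =
      (#{i | g (Quotient.mk _ i) = b} : ℤ) := by
    intro g b
    rw [← Nat.cast_sum]
    congr 1
    rw [Finset.card_eq_sum_card_fiberwise (f := fun i => Quotient.mk (Perm.SameCycle.setoid σ) i)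
      (t := ({q | g q = b} : Finset _)) (by intro i hi; simpa using hi)]
    refine Finset.sum_congr rfl fun q hq => ?_
    congr 1
    ext i
    simp only [mem_filter, mem_univ, true_and, iff_and_self] at hq ⊢
    rintro rfl
    exact hq
  refine Finset.card_bij (fun g _ => g ∘ Quotient.mk _) ?_ ?_ ?_
  · intro g hg
    simp only [mem_filter, mem_univ, true_and, hsum] at hg ⊢
    refine ⟨(comp_eq_iff_sameCycle _ _).2 fun i j hij => ?_, hg⟩
    exact congrArg g (Quotient.sound hij)
  · intro g _ g' _ h
    funext q
    induction q using Quotient.inductionOn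
    exact congrFun h _
  · intro g hg
    simp only [mem_filter, mem_univ, true_and] at hg
    refine ⟨fun q => Quotient.liftOn q g ((comp_eq_iff_sameCycle _ _).1 hg.1), ?_, rfl⟩
    simp only [mem_filter, mem_univ, true_and, hsum]
    exact hg.2

theorem card_bool_colorings {n : ℕ} (σ : Perm (Fin n)) (kt kf : ℤ) (hk : kt + kf = n)
    (S : Finset (Fin n → Bool)) (hS : ∀ A, A ∈ S ↔ (trueCard A : ℤ) = kt) :
    #{g : Fin n → Bool | g ∘ σ = g ∧ ∀ b, (#{i | g i = b} : ℤ) = bif b then kt else kf} =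
      fixCount S σ := by
  unfold fixCount
  congr 1
  ext A
  simp only [mem_filter, mem_univ, true_and, Bool.forall_bool, cond_true, cond_false, hS]
  have : trueCard A + #{i | A i = false} = n := by
    have := Finset.card_filter_add_card_filter_not (s := (univ : Finset (Fin n)))
      (fun i => A i = true)
    simpa [trueCard] using this
  unfold trueCard at this ⊢
  constructor
  · rintro ⟨h1, h2, h3⟩
    exact ⟨h3, h1⟩
  · rintro ⟨h1, h2⟩
    exact ⟨h2, by omega, h1⟩

theorem sum_sign_mul_card_fixed_colorings (n c : ℕ) (hn : n = 2 * c) (σ : Perm (Fin n)) :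
    ∑ τ : Perm (Fin c), (Perm.sign τ : ℤ) *
        (#{g : Fin n → Fin c | g ∘ σ = g ∧
          ∀ b, (#{i | g i = b} : ℤ) = 2 - (b : ℤ) + (τ b : ℕ)} : ℤ) =
      Perm.sign σ * ((fixCount (level n c) σ : ℤ) - fixCount (levelPred n c) σ) := by
  classical
  have key := sum_sign_mul_card_colorings (Q := Quotient (Perm.SameCycle.setoid σ))
    (fun q => #{i : Fin n | (Quotient.mk _ i : Quotient (Perm.SameCycle.setoid σ)) = q})
    (fun q => by
      induction q using Quotient.inductionOn with
      | h i => exact card_pos.2 ⟨i, by simp⟩) c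
  have e1 := card_bool_colorings σ c c (by omega) (level n c) (by simp [level])
  have e2 := card_bool_colorings σ (c - 1) (c + 1) (by omega) (levelPred n c) (by
    intro A
    simp only [levelPred, mem_filter, mem_univ, true_and]
    omega)
  simp only [Bool.cond_self] at e1
  have hsign : (Perm.sign σ : ℤ) = (-1) ^ Fintype.card (Quotient (Perm.SameCycle.setoid σ)) := by
    have h2 : (-1 : ℤˣ) ^ n = 1 := Even.neg_one_pow ⟨c, by omega⟩
    rw [sign_eq_neg_one_pow_card_quotient, Fintype.card_fin, pow_add, h2, one_mul]
    simp
  have f1 := (card_colorings_quotient σ (fun _ : Bool => (c : ℤ))).trans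
    (Eq.trans (by congr!) e1)
  have f2 := (card_colorings_quotient σ
    (fun b : Bool => bif b then (c : ℤ) - 1 else c + 1)).trans (Eq.trans (by congr!) e2)
  rw [hsign, ← f1, ← f2]
  refine Eq.trans ?_ (key.trans (by congr!))
  refine Finset.sum_congr rfl fun τ _ => ?_
  have f3 := card_colorings_quotient σ (fun b : Fin c => 2 - (b : ℤ) + (τ b : ℕ))
  congr 2
  refine Eq.trans ?_ (f3.symm.trans (by congr!))
  congr!

/-- An action of `G` on `n` coordinate axes by signed permutations: the underlying permutations
`p` and the signs `s`. -/
structure SignedAction (G : Type) [Group G] (n : ℕ) where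
  p : G →* Perm (Fin n)
  s : G → Fin n → ℂ
  s_mul : ∀ g h i, s (g * h) i = s g (p h i) * s h i
  s_sq : ∀ g i, s g i * s g i = 1

namespace SignedAction

variable {G : Type} [Group G] {n : ℕ} (ω : SignedAction G n)

theorem s_one (i : Fin n) : ω.s 1 i = 1 := by
  have h := ω.s_mul 1 1 i
  simp only [mul_one, map_one, Perm.one_apply] at h
  rw [h, ω.s_sq]

/-- The character of the signed permutation representation. -/
def char (g : G) : ℂ := ∑ i, if ω.p g i = i then ω.s g i else 0

/-- The trace of `g` on the span of the monomials of degree `d`. -/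
def symTrace (d : ℕ) (g : G) : ℂ :=
  ∑ m ∈ (univ : Finset (Fin n)).piAntidiag d, if m ∘ ω.p g = m then ∏ i, ω.s g i ^ m i else 0

theorem symTrace_zero (g : G) : ω.symTrace 0 g = 1 := by
  simp [symTrace]

theorem s_pow (g : G) (i : Fin n) (k : ℕ) :
    ω.s (g ^ k) i = ∏ j ∈ range k, ω.s g ((ω.p g)^[j] i) := by
  induction k with
  | zero => simp [s_one]
  | succ k ih =>
    rw [pow_succ', ω.s_mul, ih, prod_range_succ, mul_comm, map_pow, Perm.iterate_eq_pow]

/-- The forward orbit of `i` under `g`. -/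
def orb (g : G) (i : Fin n) : Finset (Fin n) :=
  (range (Function.minimalPeriod (ω.p g) i)).image fun k => (ω.p g)^[k] i

theorem period_pos (g : G) (i : Fin n) : 0 < Function.minimalPeriod (ω.p g) i :=
  Function.minimalPeriod_pos_of_mem_periodicPts
    (Function.Injective.mem_periodicPts (ω.p g).injective i)

theorem mem_orb {g : G} {i j : Fin n} : j ∈ ω.orb g i ↔ ∃ k, (ω.p g)^[k] i = j := by
  simp only [orb, mem_image, mem_range]
  constructor
  · rintro ⟨k, -, h⟩
    exact ⟨k, h⟩
  · rintro ⟨k, h⟩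
    exact ⟨k % _, Nat.mod_lt _ (ω.period_pos g i), by rwa [Function.iterate_mod_minimalPeriod_eq]⟩

theorem apply_mem_orb {g : G} {i j : Fin n} : ω.p g j ∈ ω.orb g i ↔ j ∈ ω.orb g i := by
  have h : ∀ j, j ∈ ω.orb g i → ω.p g j ∈ ω.orb g i := by
    intro j hj
    obtain ⟨k, rfl⟩ := ω.mem_orb.1 hj
    exact ω.mem_orb.2 ⟨k + 1, Function.iterate_succ_apply' _ _ _⟩
  refine ⟨fun hj => ?_, h j⟩
  have him : (ω.orb g i).image (ω.p g) = ω.orb g i := by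
    apply Finset.eq_of_subset_of_card_le
    · intro x hx
      obtain ⟨y, hy, rfl⟩ := mem_image.1 hx
      exact h y hy
    · rw [card_image_of_injective _ (ω.p g).injective]
  rw [← him] at hj
  obtain ⟨y, hy, h1⟩ := mem_image.1 hj
  rwa [← (ω.p g).injective h1]

theorem injOn_iterate (g : G) (i : Fin n) :
    Set.InjOn (fun k => (ω.p g)^[k] i) (range (Function.minimalPeriod (ω.p g) i)) := by
  intro k hk k' hk' h
  simp only [coe_range, Set.mem_Iio] at hk hk'
  exact (Function.iterate_eq_iterate_iff_of_lt_minimalPeriod hk hk').1 h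

theorem card_orb (g : G) (i : Fin n) : #(ω.orb g i) = Function.minimalPeriod (ω.p g) i := by
  rw [orb, card_image_of_injOn (ω.injOn_iterate g i), card_range]

theorem prod_orb (g : G) (i : Fin n) :
    ∏ j ∈ ω.orb g i, ω.s g j = ω.s (g ^ Function.minimalPeriod (ω.p g) i) i := by
  rw [orb, prod_image (ω.injOn_iterate g i), s_pow]

theorem self_mem_orb (g : G) (i : Fin n) : i ∈ ω.orb g i := ω.mem_orb.2 ⟨0, rfl⟩

theorem eq_of_mem_orb {g : G} {i j : Fin n} {m : Fin n → ℕ} (hm : m ∘ ω.p g = m)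
    (hj : j ∈ ω.orb g i) : m j = m i := by
  obtain ⟨k, rfl⟩ := ω.mem_orb.1 hj
  induction k with
  | zero => rfl
  | succ k ih =>
    rw [Function.iterate_succ_apply']
    exact (congrFun hm _).trans (ih (ω.mem_orb.2 ⟨k, rfl⟩))

/-- The degree weighted by the exponent of the `i`-th variable. -/
def weightedTrace (d : ℕ) (i : Fin n) (g : G) : ℂ :=
  ∑ m ∈ (univ : Finset (Fin n)).piAntidiag d,
    if m ∘ ω.p g = m then (m i : ℂ) * ∏ i, ω.s g i ^ m i else 0

theorem weightedTrace_of_lt {d : ℕ} {i : Fin n} {g : G}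
    (hd : d < Function.minimalPeriod (ω.p g) i) : ω.weightedTrace d i g = 0 := by
  refine sum_eq_zero fun m hm => ?_
  split_ifs with h
  · rw [mem_piAntidiag] at hm
    have hmi : m i = 0 := by
      by_contra h0
      have h1 : ∑ j ∈ ω.orb g i, m j ≤ d := by
        rw [← hm.1]
        exact sum_le_sum_of_subset (subset_univ _)
      rw [sum_congr rfl fun j hj => ω.eq_of_mem_orb h hj, sum_const, card_orb, smul_eq_mul] at h1
      have := Nat.le_mul_of_pos_right (Function.minimalPeriod (ω.p g) i) (Nat.pos_of_ne_zero h0)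
      omega
    simp [hmi]
  · rfl

theorem weightedTrace_add (d : ℕ) (i : Fin n) (g : G) :
    ω.weightedTrace (d + Function.minimalPeriod (ω.p g) i) i g =
      ω.s (g ^ Function.minimalPeriod (ω.p g) i) i *
        (ω.weightedTrace d i g + ω.symTrace d g) := by
  classical
  set l := Function.minimalPeriod (ω.p g) i with hl
  set u : Fin n → ℕ := fun j => if j ∈ ω.orb g i then 1 else 0 with hu
  have hug : u ∘ ω.p g = u := by
    funext j
    simp only [hu, Function.comp, ω.apply_mem_orb]
  have husum : ∑ j, u j = l := by
    simp only [hu, sum_boole, filter_mem_eq_inter, univ_inter, Nat.cast_id, card_orb, hl]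
  have hui : u i = 1 := by simp [hu, self_mem_orb]
  have hinv : ∀ m : Fin n → ℕ, (m + u) ∘ ω.p g = m + u ↔ m ∘ ω.p g = m := by
    intro m
    constructor
    · intro h
      funext j
      have h1 := congrFun h j
      have h2 := congrFun hug j
      simp only [Function.comp, Pi.add_apply] at h1 h2 ⊢
      omega
    · intro h
      funext j
      have h1 := congrFun h j
      have h2 := congrFun hug j
      simp only [Function.comp, Pi.add_apply] at h1 h2 ⊢
      omega
  have hprod : ∀ m : Fin n → ℕ, ∏ j, ω.s g j ^ (m + u) j =
      ω.s (g ^ l) i * ∏ j, ω.s g j ^ m j := by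
    intro m
    simp only [Pi.add_apply, pow_add, prod_mul_distrib]
    rw [mul_comm, hl, ← prod_orb]
    congr 1
    rw [← prod_filter_mul_prod_filter_not univ (· ∈ ω.orb g i)]
    rw [prod_congr rfl (g := fun j => ω.s g j) (by intro j hj; simp_all),
      prod_congr (s₁ := {j | j ∉ ω.orb g i}) rfl (g := fun j => 1) (by intro j hj; simp_all)]
    simp
  rw [weightedTrace, weightedTrace, symTrace, ← sum_add_distrib, mul_sum]
  symm
  refine sum_of_injOn (fun m => m + u) ?_ ?_ ?_ ?_
  · intro m _ m' _ h
    simpa using h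
  · intro m hm
    simp only [mem_coe, mem_piAntidiag] at hm ⊢
    refine ⟨?_, by simp⟩
    simp [sum_add_distrib, hm, husum]
  · intro m hm hm'
    split_ifs with h
    · have hmi : m i = 0 := by
        by_contra h0
        apply hm'
        refine ⟨m - u, ?_, ?_⟩
        · simp only [mem_coe, mem_piAntidiag] at hm ⊢
          refine ⟨?_, by simp⟩
          have h1 : univ.sum (m - u) + univ.sum u = univ.sum m := by
            rw [← sum_add_distrib]
            refine sum_congr rfl fun j _ => ?_
            simp only [Pi.sub_apply, hu]
            split_ifs with hj
            · have := ω.eq_of_mem_orb h hj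
              omega
            · simp
          have h2 := hm.1
          have h3 : univ.sum u = l := husum
          omega
        · funext j
          simp only [Pi.add_apply, Pi.sub_apply, hu]
          split_ifs with hj
          · have := ω.eq_of_mem_orb h hj
            omega
          · simp
      simp [hmi]
    · rfl
  · intro m _
    simp only [hinv]
    split_ifs with h
    · rw [hprod, Pi.add_apply, hui]
      push_cast
      ring
    · simp

/-- The contribution of the `i`-th axis to Newton's recursion. -/
def newtonSum (d : ℕ) (i : Fin n) (g : G) : ℂ :=
  ∑ k ∈ range d, (if ω.p (g ^ (k + 1)) i = i then ω.s (g ^ (k + 1)) i else 0) *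
    ω.symTrace (d - 1 - k) g

theorem p_pow_eq_iff (g : G) (i : Fin n) (k : ℕ) :
    ω.p (g ^ k) i = i ↔ Function.minimalPeriod (ω.p g) i ∣ k := by
  rw [map_pow, ← Perm.iterate_eq_pow, ← Function.isPeriodicPt_iff_minimalPeriod_dvd]
  rfl

theorem newtonSum_of_lt {d : ℕ} {i : Fin n} {g : G}
    (hd : d < Function.minimalPeriod (ω.p g) i) : ω.newtonSum d i g = 0 := by
  refine sum_eq_zero fun k hk => ?_
  rw [mem_range] at hk
  rw [if_neg, zero_mul]
  rw [p_pow_eq_iff]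
  intro h
  have := Nat.le_of_dvd (by omega) h
  omega

theorem newtonSum_add (d : ℕ) (i : Fin n) (g : G) :
    ω.newtonSum (d + Function.minimalPeriod (ω.p g) i) i g =
      ω.s (g ^ Function.minimalPeriod (ω.p g) i) i *
        (ω.newtonSum d i g + ω.symTrace d g) := by
  set l := Function.minimalPeriod (ω.p g) i with hl
  have hlpos : 0 < l := ω.period_pos g i
  rw [newtonSum, add_comm d l, sum_range_add]
  have hfirst : ∑ k ∈ range l, (if ω.p (g ^ (k + 1)) i = i then ω.s (g ^ (k + 1)) i else 0) *
      ω.symTrace (l + d - 1 - k) g = ω.s (g ^ l) i * ω.symTrace d g := by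
    rw [sum_eq_single_of_mem (l - 1) (by simp; omega)]
    · rw [Nat.sub_add_cancel hlpos, if_pos ((ω.p_pow_eq_iff g i l).2 dvd_rfl)]
      congr 2
      omega
    · intro k hk hk'
      rw [mem_range] at hk
      rw [if_neg, zero_mul]
      rw [p_pow_eq_iff]
      intro h
      have := Nat.le_of_dvd (by omega) h
      omega
  rw [hfirst, mul_add, add_comm, newtonSum, mul_sum]
  congr 1
  refine sum_congr rfl fun k _ => ?_
  have h1 : (ω.p (g ^ (l + k + 1)) i = i) ↔ ω.p (g ^ (k + 1)) i = i := by
    rw [p_pow_eq_iff, p_pow_eq_iff, ← hl, add_assoc, Nat.dvd_add_right dvd_rfl]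
  simp only [h1]
  have h2 : l + d - 1 - (l + k) = d - 1 - k := by omega
  rw [h2]
  split_ifs with h
  · rw [add_assoc, pow_add, ω.s_mul, h, mul_assoc]
  · simp

theorem weightedTrace_eq_newtonSum (d : ℕ) (i : Fin n) (g : G) :
    ω.weightedTrace d i g = ω.newtonSum d i g := by
  induction d using Nat.strong_induction_on with
  | _ d ih =>
    rcases lt_or_ge d (Function.minimalPeriod (ω.p g) i) with h | h
    · rw [weightedTrace_of_lt _ h, newtonSum_of_lt _ h]
    · obtain ⟨e, rfl⟩ := Nat.exists_eq_add_of_le' h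
      rw [weightedTrace_add, newtonSum_add, ih e (by have := ω.period_pos g i; omega)]

theorem symTrace_succ (d : ℕ) (g : G) :
    ω.symTrace (d + 1) g = ((d : ℂ) + 1)⁻¹ *
      ∑ k ∈ range (d + 1), ω.char (g ^ (k + 1)) * ω.symTrace (d - k) g := by
  have hd : (d : ℂ) + 1 ≠ 0 := Nat.cast_add_one_ne_zero d
  rw [eq_inv_mul_iff_mul_eq₀ hd]
  have h1 : ((d : ℂ) + 1) * ω.symTrace (d + 1) g = ∑ i, ω.weightedTrace (d + 1) i g := by
    simp only [weightedTrace]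
    rw [sum_comm, symTrace, mul_sum]
    refine sum_congr rfl fun m hm => ?_
    rw [mem_piAntidiag] at hm
    split_ifs with h
    · rw [← sum_mul, ← Nat.cast_sum, hm.1]
      push_cast
      ring
    · simp
  rw [h1]
  simp only [weightedTrace_eq_newtonSum, newtonSum, char, sum_mul]
  rw [sum_comm]
  simp

theorem symChar_char (d : ℕ) (g : G) : symChar ω.char d g = ω.symTrace d g := by
  induction d using Nat.strong_induction_on with
  | _ d ih =>
    cases d with
    | zero => rw [symTrace_zero, symChar]
    | succ d =>
      rw [symTrace_succ, symChar]
      congr 1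
      refine sum_congr rfl fun k _ => ?_
      rw [ih (d - k) (by omega)]

end SignedAction

theorem mul_pred_le_sum_of_injOn {ι : Type*} [DecidableEq ι] (m : ι → ℕ) (s : Finset ι) :
    Set.InjOn m s → (∀ i ∈ s, ∀ j ∈ s, m i % 2 = m j % 2) →
    #s * (#s - 1) ≤ ∑ i ∈ s, m i ∧
      (∑ i ∈ s, m i = #s * (#s - 1) → ∀ i ∈ s, Even (m i) ∧ m i < 2 * #s) := by
  induction s using Finset.induction_on_max_value m with
  | empty => simp
  | insert a s ha hmax ih =>
    intro hinj hpar
    obtain ⟨ih1, ih2⟩ := ih (hinj.mono (by simp))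
      (fun i hi j hj => hpar i (mem_insert_of_mem hi) j (mem_insert_of_mem hj))
    have hk : 2 * #s ≤ m a := by
      have h1 : #((insert a s).image fun i => m i / 2) ≤ #(range (m a / 2 + 1)) := by
        apply card_le_card
        intro x hx
        obtain ⟨i, hi, rfl⟩ := mem_image.1 hx
        have : m i ≤ m a := by
          rcases mem_insert.1 hi with rfl | hi
          · exact le_rfl
          · exact hmax i hi
        rw [mem_range]
        omega
      rw [card_image_of_injOn, card_insert_of_notMem ha, card_range] at h1
      · omega
      · intro i hi j hj h
        apply hinj hi hj
        have := hpar i hi j hj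
        simp only at h
        omega
    rw [card_insert_of_notMem ha, sum_insert ha, Nat.add_sub_cancel]
    have hring : (#s + 1) * #s = 2 * #s + #s * (#s - 1) := by
      cases #s with
      | zero => rfl
      | succ k => simp only [Nat.add_sub_cancel]; ring
    rw [hring]
    refine ⟨by omega, fun h i hi => ?_⟩
    rcases mem_insert.1 hi with rfl | hi
    · have : m i = 2 * #s := by omega
      exact ⟨⟨#s, by omega⟩, by omega⟩
    · obtain ⟨h1, h2⟩ := ih2 (by omega) i hi
      exact ⟨h1, by omega⟩

namespace SignedAction

variable {G : Type} [Group G] {n : ℕ} (ω : SignedAction G n)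

/-- The sign by which `g` acts on the `m`-th monomial twisted by the sign of the underlying
permutation. -/
def weight (m : Fin n → ℕ) (g : G) : ℂ := ((Perm.sign (ω.p g) : ℤ) : ℂ) * ∏ i, ω.s g i ^ m i

open Classical in
/-- The weight of `g` if `g` fixes `A` and `m`. -/
def stabWeight (A : Fin n → Bool) (m : Fin n → ℕ) (g : G) : ℂ :=
  if A ∘ ω.p g = A ∧ m ∘ ω.p g = m then ω.weight m g else 0

theorem weight_mul {m : Fin n → ℕ} {g h : G} (hm : m ∘ ω.p h = m) :
    ω.weight m (g * h) = ω.weight m g * ω.weight m h := by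
  have h1 : ∏ i, ω.s g (ω.p h i) ^ m i = ∏ i, ω.s g i ^ m i := by
    rw [← Equiv.prod_comp (ω.p h) (fun i => ω.s g i ^ m i)]
    exact prod_congr rfl fun i _ => by rw [show m (ω.p h i) = m i from congrFun hm i]
  simp only [weight, ω.s_mul, mul_pow, prod_mul_distrib, h1, map_mul, Units.val_mul]
  push_cast
  ring

theorem sum_stabWeight_eq_zero [Fintype G] {A : Fin n → Bool} {m : Fin n → ℕ} {g : G}
    (hA : A ∘ ω.p g = A) (hm : m ∘ ω.p g = m) (hw : ω.weight m g = -1) :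
    ∑ h, ω.stabWeight A m h = 0 := by
  have h1 : ∑ h, ω.stabWeight A m h = ∑ h, -ω.stabWeight A m h := by
    rw [← Equiv.sum_comp (Equiv.mulLeft g)]
    refine sum_congr rfl fun h _ => ?_
    have hA' : A ∘ ω.p (g * h) = A ↔ A ∘ ω.p h = A := by
      rw [map_mul, Perm.coe_mul, ← Function.comp_assoc, hA]
    have hm' : m ∘ ω.p (g * h) = m ↔ m ∘ ω.p h = m := by
      rw [map_mul, Perm.coe_mul, ← Function.comp_assoc, hm]
    simp only [stabWeight, Equiv.coe_mulLeft, hA', hm']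
    split_ifs with h2
    · rw [ω.weight_mul h2.2, hw, neg_one_mul]
    · simp
  rw [sum_neg_distrib] at h1
  exact self_eq_neg.1 h1

/-- The sum whose average is the multiplicity, in degree `d`, of the permutation character
on `X` twisted by the sign. -/
def twistedSum [Fintype G] (X : Finset (Fin n → Bool)) (d : ℕ) : ℂ :=
  ∑ g, ((Perm.sign (ω.p g) : ℤ) : ℂ) * fixCount X (ω.p g) * ω.symTrace d g

theorem twistedSum_eq [Fintype G] (X : Finset (Fin n → Bool)) (d : ℕ) :
    ω.twistedSum X d = ∑ A ∈ X, ∑ m ∈ (univ : Finset (Fin n)).piAntidiag d,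
      ∑ g, ω.stabWeight A m g := by
  simp only [sum_comm (s := (univ : Finset (Fin n)).piAntidiag d)]
  rw [sum_comm, twistedSum]
  refine sum_congr rfl fun g _ => ?_
  rw [fixCount, card_filter, symTrace, mul_assoc]
  push_cast
  rw [sum_mul_sum, mul_sum]
  refine sum_congr rfl fun A _ => ?_
  rw [mul_sum]
  refine sum_congr rfl fun m _ => ?_
  simp only [stabWeight, weight]
  by_cases h1 : A ∘ ω.p g = A <;> by_cases h2 : m ∘ ω.p g = m <;> simp [h1, h2]

/-- The group is large enough relative to the colorings in `X`: the underlying permutations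
are arbitrary as long as they stay in `X`, and pairs of signs in the same color can be changed. -/
structure Ample (X : Finset (Fin n → Bool)) : Prop where
  stable : ∀ g, ∀ A ∈ X, A ∘ ω.p g ∈ X
  lift : ∀ σ : Perm (Fin n), ∀ A ∈ X, A ∘ σ ∈ X → ∃ g, ω.p g = σ ∧ ∀ i, ω.s g i = 1
  signs : ∀ A ∈ X, ∀ i j, i ≠ j → A i = A j → ∃ g, ω.p g = 1 ∧ ω.s g i = -1 ∧ ω.s g j = -1 ∧
    ∀ k, k ≠ i → k ≠ j → ω.s g k = 1

variable {ω} {X : Finset (Fin n → Bool)}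

theorem Ample.eq_and_parity [Fintype G] (hX : ω.Ample X) {A : Fin n → Bool} (hA : A ∈ X)
    {m : Fin n → ℕ} (hm : ∑ g, ω.stabWeight A m g ≠ 0) {i j : Fin n} (hij : A i = A j) :
    (m i = m j → i = j) ∧ m i % 2 = m j % 2 := by
  constructor
  · intro h
    by_contra hne
    have key : ∀ {β : Type} (F : Fin n → β), F i = F j → F ∘ swap i j = F := by
      intro β F hF
      funext x
      rcases eq_or_ne x i with rfl | hx
      · simp [hF]
      rcases eq_or_ne x j with rfl | hx'
      · simp [hF]
      simp [swap_apply_of_ne_of_ne hx hx']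
    have hA1 := key A hij
    obtain ⟨g, hg, hs⟩ := hX.lift (swap i j) A hA (hA1.symm ▸ hA)
    refine hm (ω.sum_stabWeight_eq_zero (g := g) (hg ▸ hA1) (hg ▸ key m h) ?_)
    simp [weight, hg, hs, Perm.sign_swap hne]
  · by_contra hpar
    have hne : i ≠ j := by
      rintro rfl
      exact hpar rfl
    obtain ⟨g, hg, hi, hj, hs⟩ := hX.signs A hA i j hne hij
    refine hm (ω.sum_stabWeight_eq_zero (g := g) (by simp [hg]) (by simp [hg]) ?_)
    rw [weight, hg, prod_eq_mul i j hne (fun k _ hk => by rw [hs k hk.1 hk.2, one_pow])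
      (by simp) (by simp), hi, hj, ← pow_add, Odd.neg_one_pow]
    · simp
    · rw [Nat.odd_iff]
      omega

theorem Ample.bound [Fintype G] (hX : ω.Ample X) {A : Fin n → Bool} (hA : A ∈ X)
    {m : Fin n → ℕ} (hm : ∑ g, ω.stabWeight A m g ≠ 0) (b : Bool) :
    #{i | A i = b} * (#{i | A i = b} - 1) ≤ ∑ i with A i = b, m i ∧
      (∑ i with A i = b, m i = #{i | A i = b} * (#{i | A i = b} - 1) →
        ∀ i, A i = b → Even (m i) ∧ m i < 2 * #{i | A i = b}) := by
  have h := mul_pred_le_sum_of_injOn m {i | A i = b}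
    (by
      intro i hi j hj
      simp only [coe_filter, mem_univ, true_and, Set.mem_ofPred_eq] at hi hj
      exact (hX.eq_and_parity hA hm (hi.trans hj.symm)).1)
    (by
      intro i hi j hj
      simp only [mem_filter, mem_univ, true_and] at hi hj
      exact (hX.eq_and_parity hA hm (hi.trans hj.symm)).2)
  simpa using h

theorem sum_bool_fibers {M : Type*} [AddCommMonoid M] (A : Fin n → Bool) (f : Fin n → M) :
    ∑ i with A i = true, f i + ∑ i with A i = false, f i = ∑ i, f i := by
  have := sum_filter_add_sum_filter_not (univ : Finset (Fin n)) (fun i => A i = true) f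
  simpa using this

theorem Ample.twistedSum_eq_zero [Fintype G] (hX : ω.Ample X) {a b d : ℕ} (hab : a + b = n)
    (hXa : ∀ A ∈ X, trueCard A = a) (hd : d < a * (a - 1) + b * (b - 1)) :
    ω.twistedSum X d = 0 := by
  rw [twistedSum_eq]
  refine sum_eq_zero fun A hA => sum_eq_zero fun m hm => ?_
  by_contra h
  have h1 := (hX.bound hA h true).1
  have h2 := (hX.bound hA h false).1
  have h3 := sum_bool_fibers A m
  have h4 := sum_bool_fibers A (fun _ => 1)
  rw [mem_piAntidiag] at hm
  have h5 := hXa A hA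
  rw [trueCard] at h5
  simp only [← card_eq_sum_ones, card_univ, Fintype.card_fin] at h4
  have h6 : #{i | A i = false} = b := by omega
  rw [h5] at h1
  rw [h6] at h2
  have h7 : ∑ i, m i = d := hm.1
  omega

/-- The orbit of colorings and exponents that carries the top degree multiplicity. -/
def staircases (X : Finset (Fin n → Bool)) (c : ℕ) : Finset ((Fin n → Bool) × (Fin n → ℕ)) :=
  {z ∈ X ×ˢ (univ : Finset (Fin n)).piAntidiag (2 * (c * (c - 1))) |
    (∀ i j, z.1 i = z.1 j → z.2 i = z.2 j → i = j) ∧ ∀ i, Even (z.2 i) ∧ z.2 i < 2 * c}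

theorem Ample.mem_staircases [Fintype G] (hX : ω.Ample X) {c : ℕ} (hn : n = 2 * c)
    (hXc : ∀ A ∈ X, trueCard A = c) {A : Fin n → Bool} (hA : A ∈ X) {m : Fin n → ℕ}
    (hm : m ∈ (univ : Finset (Fin n)).piAntidiag (2 * (c * (c - 1))))
    (h : ∑ g, ω.stabWeight A m g ≠ 0) : (A, m) ∈ staircases X c := by
  rw [staircases, mem_filter]
  refine ⟨mem_product.2 ⟨hA, hm⟩, fun i j h1 h2 => (hX.eq_and_parity hA h h1).1 h2, ?_⟩
  obtain ⟨h1, h1'⟩ := hX.bound hA h true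
  obtain ⟨h2, h2'⟩ := hX.bound hA h false
  have h3 := sum_bool_fibers A m
  have h4 := sum_bool_fibers A (fun _ => 1)
  rw [mem_piAntidiag] at hm
  have h5 := hXc A hA
  rw [trueCard] at h5
  simp only [← card_eq_sum_ones, card_univ, Fintype.card_fin] at h4
  have h6 : #{i | A i = false} = c := by omega
  rw [h5] at h1 h1'
  rw [h6] at h2 h2'
  have h7 : ∑ i, m i = 2 * (c * (c - 1)) := hm.1
  intro i
  cases hi : A i with
  | true => exact h1' (by omega) i hi
  | false => exact h2' (by omega) i hi

/-- A member of `staircases X c` as a bijection onto the standard staircases. -/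
theorem exists_equiv_of_mem_staircases {c : ℕ} (hn : n = 2 * c)
    {z : (Fin n → Bool) × (Fin n → ℕ)} (hz : z ∈ staircases X c) :
    ∃ e : Fin n ≃ Bool × Fin c, ∀ i, z.1 i = (e i).1 ∧ z.2 i = 2 * ((e i).2 : ℕ) := by
  simp only [staircases, mem_filter] at hz
  obtain ⟨-, hinj, hz⟩ := hz
  have hlt : ∀ i, z.2 i / 2 < c := fun i => by have := (hz i).2; omega
  have hbij : Function.Bijective (fun i => ((z.1 i, ⟨z.2 i / 2, hlt i⟩) : Bool × Fin c)) := by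
    rw [Fintype.bijective_iff_injective_and_card]
    refine ⟨fun i j hij => ?_, by simp [hn]⟩
    simp only [Prod.mk.injEq, Fin.mk.injEq] at hij
    refine hinj i j hij.1 ?_
    have h1 := (hz i).1.two_dvd
    have h2 := (hz j).1.two_dvd
    omega
  refine ⟨Equiv.ofBijective _ hbij, fun i => ⟨rfl, ?_⟩⟩
  have h1 := (hz i).1.two_dvd
  simp only [Equiv.ofBijective_apply]
  omega

theorem staircases_nonempty {c : ℕ} (hn : n = 2 * c) (hXc : ∀ A ∈ X, trueCard A = c)
    (hne : X.Nonempty) : (staircases X c).Nonempty := by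
  obtain ⟨A, hA⟩ := hne
  have e : Fin n ≃ Bool × Fin c := Fintype.equivOfCardEq (by simp [hn])
  have hfib : ∀ b, #{i | (e i).1 = b} = c := by
    intro b
    have : ({i | (e i).1 = b} : Finset (Fin n)) =
        (univ : Finset (Fin c)).image fun t => e.symm (b, t) := by
      ext i
      simp only [mem_filter, mem_univ, true_and, mem_image]
      constructor
      · rintro rfl
        exact ⟨(e i).2, by simp⟩
      · rintro ⟨t, rfl⟩
        simp
    rw [this, card_image_of_injective _ fun t t' h => by simpa using h, card_univ,
      Fintype.card_fin]
  obtain ⟨σ, hσ⟩ := exists_perm_comp_eq A (fun i => (e i).1) (by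
    intro b
    have h4 := sum_bool_fibers A (fun _ => 1)
    have h5 := hXc A hA
    rw [trueCard] at h5
    simp only [← card_eq_sum_ones, card_univ, Fintype.card_fin] at h4
    rw [hfib]
    cases b <;> omega)
  refine ⟨(A, fun i => 2 * ((e (σ i)).2 : ℕ)), ?_⟩
  simp only [staircases, mem_filter, mem_product, mem_piAntidiag]
  refine ⟨⟨hA, ?_, by simp⟩, ?_, ?_⟩
  · rw [show ∑ i, 2 * ((e (σ i)).2 : ℕ) = ∑ x : Bool × Fin c, 2 * (x.2 : ℕ) from
      Equiv.sum_comp (σ.trans e) (fun x : Bool × Fin c => 2 * (x.2 : ℕ)),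
      Fintype.sum_prod_type, Fintype.sum_bool, ← mul_sum,
      Fin.sum_univ_eq_sum_range (fun t => t),
      mul_comm 2 (∑ i ∈ range c, i), Finset.sum_range_id_mul_two]
    ring
  · intro i j h1 h2
    rw [← hσ] at h1
    refine σ.injective (e.injective (Prod.ext h1 (Fin.ext ?_)))
    omega
  · intro i
    have := (e (σ i)).2.isLt
    exact ⟨even_two_mul _, by omega⟩

theorem Ample.twistedSum_eq_card [Fintype G] (hX : ω.Ample X) {c : ℕ} (hn : n = 2 * c)
    (hXc : ∀ A ∈ X, trueCard A = c) (hne : X.Nonempty) :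
    ω.twistedSum X (2 * (c * (c - 1))) = Fintype.card G := by
  classical
  have hp : ∀ z ∈ staircases X c, ∀ g, z.1 ∘ ω.p g = z.1 → z.2 ∘ ω.p g = z.2 → ω.p g = 1 := by
    intro z hz g h1 h2
    simp only [staircases, mem_filter] at hz
    ext1 i
    exact hz.2.1 _ _ (congrFun h1 i) (congrFun h2 i)
  have hterm : ∀ z ∈ staircases X c, ∀ g, ω.stabWeight z.1 z.2 g =
      if (z.1 ∘ ω.p g⁻¹, z.2 ∘ ω.p g⁻¹) = z then 1 else 0 := by
    intro z hz g
    have hfix : (z.1 ∘ ω.p g⁻¹, z.2 ∘ ω.p g⁻¹) = z ↔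
        z.1 ∘ ω.p g = z.1 ∧ z.2 ∘ ω.p g = z.2 := by
      have key : ∀ {β : Type} (F : Fin n → β), F ∘ ω.p g⁻¹ = F ↔ F ∘ ω.p g = F := by
        intro β F
        rw [map_inv]
        exact (Equiv.comp_symm_eq (ω.p g) F F).trans eq_comm
      rw [Prod.ext_iff, key, key]
    simp only [hfix, stabWeight]
    split_ifs with h
    · rw [weight, hp z hz g h.1 h.2, Perm.sign_one, prod_eq_one]
      · simp
      · intro i _
        simp only [staircases, mem_filter] at hz
        obtain ⟨k, hk⟩ := (hz.2.2 i).1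
        rw [hk, pow_add, ← mul_pow, ω.s_sq, one_pow]
    · rfl
  have hsum : ω.twistedSum X (2 * (c * (c - 1))) =
      ∑ z ∈ staircases X c, ∑ g, ω.stabWeight z.1 z.2 g := by
    rw [twistedSum_eq, ← sum_product']
    symm
    refine sum_subset (filter_subset _ _) fun z hz hz' => ?_
    by_contra h
    rw [mem_product] at hz
    exact hz' (hX.mem_staircases hn hXc hz.1 hz.2 h)
  have key := sum_card_fixed_eq (G := G) (ι := Unit)
    (fun g (z : (Fin n → Bool) × (Fin n → ℕ)) => (z.1 ∘ ω.p g⁻¹, z.2 ∘ ω.p g⁻¹))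
    (by simp) (by
      intro g h z
      simp [Function.comp_assoc, mul_inv_rev]) (staircases X c)
    (by
      intro g z hz
      simp only [staircases, mem_filter, mem_product, mem_piAntidiag] at hz ⊢
      refine ⟨⟨?_, ?_, by simp⟩, ?_, ?_⟩
      · exact hX.stable _ _ hz.1.1
      · rw [← hz.1.2.1]
        exact Equiv.sum_comp (ω.p g⁻¹) z.2
      · intro i j h1 h2
        exact (ω.p g⁻¹).injective (hz.2.1 _ _ h1 h2)
      · intro i
        exact hz.2.2 _)
    (fun _ => ()) (by
      intro z hz z' hz'
      simp only [true_iff]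
      obtain ⟨e, he⟩ := exists_equiv_of_mem_staircases hn hz
      obtain ⟨e', he'⟩ := exists_equiv_of_mem_staircases hn hz'
      have h1 : z'.1 ∘ (e.trans e'.symm) = z.1 := by
        funext i
        simp [he, he']
      have h2 : z'.2 ∘ (e.trans e'.symm) = z.2 := by
        funext i
        simp [he, he']
      simp only [staircases, mem_filter, mem_product] at hz hz'
      obtain ⟨g, hg, -⟩ := hX.lift (e.trans e'.symm) z'.1 hz'.1.1 (h1 ▸ hz.1.1)
      refine ⟨g, ?_⟩
      rw [← h1, ← h2, ← hg]
      ext i <;> simp)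
  rw [image_const (staircases_nonempty hn hXc hne), card_singleton, one_mul] at key
  rw [hsum, sum_comm, ← key, Nat.cast_sum]
  refine sum_congr rfl fun g _ => ?_
  rw [card_filter, Nat.cast_sum]
  refine sum_congr rfl fun z hz => ?_
  rw [hterm z hz g]
  push_cast
  rfl

end SignedAction

theorem trace_eq_trace_add_trace_mapQ {V W : Type*} [AddCommGroup V] [Module ℂ V]
    [FiniteDimensional ℂ V] [AddCommGroup W] [Module ℂ W] [FiniteDimensional ℂ W]
    (U : W →ₗ[ℂ] V) (hU : Function.Injective U) (f : V →ₗ[ℂ] V) (h : W →ₗ[ℂ] W)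
    (hfU : f ∘ₗ U = U ∘ₗ h)
    (hle : LinearMap.range U ≤ (LinearMap.range U).comap f) :
    LinearMap.trace ℂ V f = LinearMap.trace ℂ W h +
      LinearMap.trace ℂ _ ((LinearMap.range U).mapQ (LinearMap.range U) f hle) := by
  obtain ⟨L, hL⟩ := LinearMap.exists_leftInverse_of_injective U (LinearMap.ker_eq_bot.2 hU)
  have hLU : ∀ w, L (U w) = w := fun w => LinearMap.congr_fun hL w
  set q := (LinearMap.range U).mkQ
  have hqU : ∀ w, q (U w) = 0 := fun w => by
    simp [q]
  let S : (V ⧸ LinearMap.range U) →ₗ[ℂ] V := (LinearMap.range U).liftQ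
    (LinearMap.id - U ∘ₗ L) (by
      rintro _ ⟨w, rfl⟩
      simp [hLU])
  have hSq : ∀ v, S (q v) = v - U (L v) := fun v => rfl
  have hsplit : f = (f ∘ₗ U) ∘ₗ L + (f ∘ₗ S) ∘ₗ q := by
    ext v
    simp only [LinearMap.add_apply, LinearMap.comp_apply, hSq, map_sub]
    abel
  have h1 : L ∘ₗ (f ∘ₗ U) = h := by
    rw [hfU, ← LinearMap.comp_assoc, hL, LinearMap.id_comp]
  have h2 : q ∘ₗ (f ∘ₗ S) = (LinearMap.range U).mapQ (LinearMap.range U) f hle := by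
    ext v
    change q (f (S (q v))) = q (f v)
    rw [hSq, map_sub, map_sub]
    have : f (U (L v)) = U (h (L v)) := LinearMap.congr_fun hfU (L v)
    rw [this, hqU, sub_zero]
  conv_lhs => rw [hsplit]
  rw [map_add, LinearMap.trace_comp_comm', h1, LinearMap.trace_comp_comm', h2]

theorem trace_funLeft {X : Type*} [Fintype X] [DecidableEq X] (e : X → X) :
    LinearMap.trace ℂ (X → ℂ) (LinearMap.funLeft ℂ ℂ e) = #{x | e x = x} := by
  rw [LinearMap.trace_eq_matrix_trace ℂ (Pi.basisFun ℂ X), Matrix.trace, card_filter]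
  push_cast
  refine sum_congr rfl fun x _ => ?_
  simp [LinearMap.funLeft_apply, Pi.single_apply]

variable {n : ℕ}

/-- Change the color of `i`. -/
def flip (i : Fin n) (A : Fin n → Bool) : Fin n → Bool := Function.update A i (!A i)

theorem flip_self (i : Fin n) (A : Fin n → Bool) : flip i A i = !A i := by simp [flip]

theorem flip_of_ne {i j : Fin n} (h : j ≠ i) (A : Fin n → Bool) : flip i A j = A j := by
  simp [flip, h]

theorem flip_flip (i : Fin n) (A : Fin n → Bool) : flip i (flip i A) = A := by
  simp [flip]

theorem flip_involutive (i : Fin n) : Function.Involutive (flip i) := flip_flip i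

theorem flip_comp (i : Fin n) (A : Fin n → Bool) (σ : Perm (Fin n)) :
    flip i (A ∘ σ) = flip (σ i) A ∘ σ := by
  funext j
  rcases eq_or_ne j i with rfl | h
  · simp [flip_self]
  · rw [flip_of_ne h, Function.comp, Function.comp, flip_of_ne (by simpa using h)]

/-- The raising operator. -/
def raise (f : (Fin n → Bool) → ℂ) (A : Fin n → Bool) : ℂ :=
  ∑ i, if A i = true then f (flip i A) else 0

/-- The lowering operator. -/
def lower (f : (Fin n → Bool) → ℂ) (A : Fin n → Bool) : ℂ :=
  ∑ i, if A i = true then 0 else f (flip i A)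

theorem sum_mul_lower (f h : (Fin n → Bool) → ℂ) :
    ∑ A, f A * lower h A = ∑ A, raise f A * h A := by
  simp only [raise, lower, mul_sum, sum_mul]
  rw [sum_comm, sum_comm (s := univ (α := Fin n → Bool))]
  refine sum_congr rfl fun i _ => ?_
  refine Fintype.sum_equiv (Function.Involutive.toPerm (flip i) (flip_involutive i)) _ _ fun A => ?_
  simp only [Function.Involutive.coe_toPerm, flip_self, flip_flip]
  cases A i <;> simp

theorem lower_raise_sub (f : (Fin n → Bool) → ℂ) (A : Fin n → Bool) :
    lower (raise f) A - raise (lower f) A = ((n : ℂ) - 2 * trueCard A) * f A := by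
  have h1 : lower (raise f) A = ∑ i, ∑ j, if A i = true then 0 else
      if flip i A j = true then f (flip j (flip i A)) else 0 := by
    simp only [raise, lower]
    refine sum_congr rfl fun i _ => ?_
    split_ifs <;> simp
  have h2 : raise (lower f) A = ∑ i, ∑ j, if A j = true then
      (if flip j A i = true then 0 else f (flip i (flip j A))) else 0 := by
    simp only [raise, lower]
    rw [sum_comm]
    refine sum_congr rfl fun i _ => ?_
    split_ifs <;> simp
  have h3 : (n : ℂ) - 2 * trueCard A = ∑ i, if A i = true then (-1 : ℂ) else 1 := by
    have h4 : ∀ i, (if A i = true then (-1 : ℂ) else 1) = 1 - 2 * if A i = true then 1 else 0 := by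
      intro i
      split_ifs <;> norm_num
    simp only [h4, sum_sub_distrib, ← mul_sum, trueCard, sum_boole]
    simp
  rw [h1, h2, h3, ← sum_sub_distrib, sum_mul]
  refine sum_congr rfl fun i _ => ?_
  rw [← sum_sub_distrib, sum_eq_single_of_mem i (mem_univ i)]
  · simp only [flip_self, flip_flip]
    cases A i <;> simp
  · intro j _ hj
    rw [flip_of_ne hj, flip_of_ne hj.symm]
    have : flip j (flip i A) = flip i (flip j A) := by
      simp only [flip, Function.update_of_ne hj, Function.update_of_ne hj.symm]
      exact Function.update_comm hj.symm _ _ _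
    rw [this]
    cases A i <;> cases A j <;> simp

theorem eq_zero_of_raise_eq_zero {c : ℕ} (hn : n = 2 * c) {f : (Fin n → Bool) → ℂ}
    (hf : ∀ A, trueCard A + 1 ≠ c → f A = 0) (hr : raise f = 0) : f = 0 := by
  have hzero : lower (raise f) = 0 := by
    rw [hr]
    funext A
    simp [lower]
  have hstar : lower (star f) = star (lower f) := by
    funext A
    simp only [lower, Pi.star_apply, star_sum]
    refine sum_congr rfl fun i _ => ?_
    split_ifs <;> simp
  have h1 : ∀ A, raise (lower f) A + 2 * f A = 0 := by
    intro A
    have h := lower_raise_sub f A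
    rw [hzero, Pi.zero_apply] at h
    by_cases hA : trueCard A + 1 = c
    · have h2 : (n : ℂ) - 2 * trueCard A = 2 := by
        have h3 : n = 2 * (trueCard A + 1) := by omega
        have h4 : (n : ℂ) = 2 * ((trueCard A : ℂ) + 1) := by exact_mod_cast h3
        rw [h4]
        ring
      rw [h2] at h
      linear_combination -h
    · rw [hf A hA] at h ⊢
      linear_combination -h
  have h2 : ∑ A, star (lower f A) * lower f A + 2 * ∑ A, star (f A) * f A = 0 := by
    have h3 : ∑ A, lower f A * lower (star f) A = ∑ A, raise (lower f) A * star f A :=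
      sum_mul_lower _ _
    rw [hstar] at h3
    simp only [Pi.star_apply] at h3
    have h4 : ∑ A, star (lower f A) * lower f A = ∑ A, lower f A * star (lower f A) :=
      sum_congr rfl fun A _ => mul_comm _ _
    rw [h4, h3, mul_sum, ← sum_add_distrib]
    refine sum_eq_zero fun A _ => ?_
    linear_combination (star (f A)) * h1 A
  have h5 : ∑ A, Complex.normSq (lower f A) + 2 * ∑ A, Complex.normSq (f A) = 0 := by
    have h6 : ∀ z : ℂ, star z * z = Complex.normSq z := fun z => by
      rw [mul_comm]
      exact Complex.mul_conj z
    simp only [h6] at h2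
    exact_mod_cast h2
  have h7 : 0 ≤ ∑ A, Complex.normSq (lower f A) := sum_nonneg fun A _ => Complex.normSq_nonneg _
  have h8 : ∀ A ∈ univ, 0 ≤ Complex.normSq (f A) := fun A _ => Complex.normSq_nonneg _
  have h9 := (sum_eq_zero_iff_of_nonneg h8).1 (by linarith [sum_nonneg h8])
  funext A
  exact Complex.normSq_eq_zero.1 (h9 A (mem_univ A))

theorem trueCard_comp (A : Fin n → Bool) (σ : Perm (Fin n)) : trueCard (A ∘ σ) = trueCard A := by
  simp only [trueCard, card_filter]
  exact Equiv.sum_comp σ (fun i => if A i = true then 1 else 0)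

theorem trueCard_flip {A : Fin n → Bool} {i : Fin n} (h : A i = true) :
    trueCard (flip i A) + 1 = trueCard A := by
  have : ({j | A j = true} : Finset (Fin n)) =
      insert i (univ.filter fun j => flip i A j = true) := by
    ext j
    simp only [mem_filter, mem_univ, true_and, mem_insert]
    rcases eq_or_ne j i with rfl | hj
    · simp [h]
    · simp [hj, flip_of_ne hj]
  rw [trueCard, trueCard, this, card_insert_of_notMem]
  simp [flip_self, h]

/-- Functions on colorings with a prescribed property, extended by zero. -/
def extendZero (X : Finset (Fin n → Bool)) : (X → ℂ) →ₗ[ℂ] (Fin n → Bool) → ℂ where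
  toFun f A := if h : A ∈ X then f ⟨A, h⟩ else 0
  map_add' f g := by
    funext A
    simp only [Pi.add_apply]
    split_ifs <;> simp
  map_smul' r f := by
    funext A
    simp only [Pi.smul_apply, RingHom.id_apply]
    split_ifs <;> simp

/-- The permutation representation on functions on a stable set of colorings, twisted by the
sign. -/
def permRep (X : Finset (Fin n → Bool)) (hX : ∀ (σ : Perm (Fin n)), ∀ A ∈ X, A ∘ σ ∈ X) :
    Representation ℂ (Perm (Fin n)) (X → ℂ) where
  toFun σ := ((Perm.sign σ : ℤ) : ℂ) • LinearMap.funLeft ℂ ℂ fun A : X => ⟨A ∘ σ, hX σ A A.2⟩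
  map_one' := by
    ext f A
    simp [LinearMap.funLeft_apply]
  map_mul' σ τ := by
    refine LinearMap.ext fun f => funext fun A => ?_
    simp [LinearMap.funLeft_apply, Function.comp_assoc, mul_left_comm, mul_assoc]

theorem trace_permRep (X : Finset (Fin n → Bool)) (hX) (σ : Perm (Fin n)) :
    LinearMap.trace ℂ _ (permRep X hX σ) = ((Perm.sign σ : ℤ) : ℂ) * fixCount X σ := by
  have h : permRep X hX σ = ((Perm.sign σ : ℤ) : ℂ) •
      LinearMap.funLeft ℂ ℂ fun A : X => ⟨A ∘ σ, hX σ A A.2⟩ := rfl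
  rw [h, map_smul, trace_funLeft, smul_eq_mul, fixCount]
  congr 2
  rw [← card_map (Function.Embedding.subtype _)]
  congr 1
  ext A
  simp [Subtype.ext_iff, and_comm]

theorem level_stable (c : ℕ) (σ : Perm (Fin n)) : ∀ A ∈ level n c, A ∘ σ ∈ level n c := by
  simp [level, trueCard_comp]

theorem levelPred_stable (c : ℕ) (σ : Perm (Fin n)) :
    ∀ A ∈ levelPred n c, A ∘ σ ∈ levelPred n c := by
  simp [levelPred, trueCard_comp]

/-- The class function `sgn ⊗ (ℂ[level] - ℂ[levelPred])`. -/
def diffChar (n c : ℕ) (σ : Perm (Fin n)) : ℂ :=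
  ((Perm.sign σ : ℤ) : ℂ) * ((fixCount (level n c) σ : ℂ) - fixCount (levelPred n c) σ)

/-- The raising operator between consecutive levels. -/
def raiseLevel (n c : ℕ) : (levelPred n c → ℂ) →ₗ[ℂ] (level n c → ℂ) where
  toFun f A := raise (extendZero _ f) A
  map_add' f g := by
    funext A
    simp only [raise, map_add, Pi.add_apply, ← sum_add_distrib]
    refine sum_congr rfl fun i _ => ?_
    split_ifs <;> simp
  map_smul' r f := by
    funext A
    simp only [raise, map_smul, Pi.smul_apply, RingHom.id_apply, smul_sum]
    refine sum_congr rfl fun i _ => ?_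
    split_ifs <;> simp

theorem raiseLevel_injective {c : ℕ} (hn : n = 2 * c) : Function.Injective (raiseLevel n c) := by
  rw [injective_iff_map_eq_zero]
  intro f hf
  have h1 : extendZero _ f = 0 := by
    apply eq_zero_of_raise_eq_zero hn
    · intro A hA
      have h : A ∉ levelPred n c := by simpa [levelPred] using hA
      simp [extendZero, h]
    · funext A
      by_cases hA : A ∈ level n c
      · exact congrFun hf ⟨A, hA⟩
      · refine sum_eq_zero fun i _ => ?_
        split_ifs with hi
        · have h := trueCard_flip hi
          simp only [level, mem_filter, mem_univ, true_and] at hA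
          have h2 : flip i A ∉ levelPred n c := by
            simp only [levelPred, mem_filter, mem_univ, true_and]
            omega
          simp [extendZero, h2]
        · rfl
  funext A
  have h := congrFun h1 A
  simpa [extendZero] using h

theorem raiseLevel_comp (c : ℕ) (σ : Perm (Fin n)) :
    permRep _ (level_stable c) σ ∘ₗ raiseLevel n c =
      raiseLevel n c ∘ₗ permRep _ (levelPred_stable c) σ := by
  refine LinearMap.ext fun f => funext fun A => ?_
  change ((Perm.sign σ : ℤ) : ℂ) * raise (extendZero _ f) (A ∘ σ) =
    raise (extendZero _ (permRep _ (levelPred_stable c) σ f)) A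
  simp only [raise, mul_sum]
  refine Fintype.sum_equiv σ _ _ fun i => ?_
  simp only [Function.comp_apply, flip_comp]
  split_ifs
  · have h : flip (σ i) (A : Fin n → Bool) ∘ σ ∈ levelPred n c ↔
        flip (σ i) (A : Fin n → Bool) ∈ levelPred n c := by
      simp [levelPred, trueCard_comp]
    simp only [extendZero, LinearMap.coe_mk, AddHom.coe_mk, h]
    split_ifs
    · rfl
    · simp
  · simp

theorem isChar_diffChar {c : ℕ} (hn : n = 2 * c) {G : Type} [Group G]
    (p : G →* Perm (Fin n)) : IsChar fun g => diffChar n c (p g) := by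
  have hle : ∀ σ, LinearMap.range (raiseLevel n c) ≤
      (LinearMap.range (raiseLevel n c)).comap (permRep _ (level_stable c) σ) := by
    rintro σ _ ⟨f, rfl⟩
    exact ⟨_, (LinearMap.congr_fun (raiseLevel_comp c σ) f).symm⟩
  refine ⟨_, inferInstance, inferInstance,
    ((permRep _ (level_stable c)).quotient (LinearMap.range (raiseLevel n c)) hle).comp p,
    inferInstance, fun g => ?_⟩
  have h := trace_eq_trace_add_trace_mapQ (raiseLevel n c) (raiseLevel_injective hn)
    (permRep _ (level_stable c) (p g)) (permRep _ (levelPred_stable c) (p g))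
    (raiseLevel_comp c (p g)) (hle (p g))
  rw [trace_permRep, trace_permRep] at h
  change _ = LinearMap.trace ℂ _ (Submodule.mapQ _ _ _ (hle (p g)))
  simp only [diffChar]
  rw [mul_sub, h]
  ring

theorem cinner_eq_sum {G : Type} [Group G] [Fintype G] (φ ψ : G → ℂ) :
    cinner φ ψ = (Fintype.card G : ℂ)⁻¹ * ∑ g, φ g * ψ g⁻¹ := by
  rw [cinner, finsum_eq_sum_of_fintype, Nat.card_eq_fintype_card]

theorem cinner_indChar {G : Type} [Group G] [Finite G] {H K : Subgroup G} (hHK : H ≤ K)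
    (χ : K → ℂ) (hχ : ∀ x y, χ (x * y * x⁻¹) = χ y) (φ : H → ℂ) :
    cinner χ (indChar H K φ) = cinner (fun h : H => χ ⟨h, hHK h.2⟩) φ := by
  classical
  have := Fintype.ofFinite G
  rw [cinner_eq_sum, cinner_eq_sum]
  simp only [indChar, finsum_eq_sum_of_fintype, Nat.card_eq_fintype_card]
  set F : K → ℂ := fun k => if h : ((k⁻¹ : K) : G) ∈ H then χ k * φ ⟨_, h⟩ else 0 with hF
  have h1 : ∀ x k : K, (χ k * if h : ((x : G) * ((k⁻¹ : K) : G) * (x : G)⁻¹) ∈ H then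
      φ ⟨_, h⟩ else 0) = F (x * k * x⁻¹) := by
    intro x k
    have h2 : (((x * k * x⁻¹)⁻¹ : K) : G) = (x : G) * ((k⁻¹ : K) : G) * (x : G)⁻¹ := by
      push_cast
      group
    have h2' : ∀ g : G, g = (((x * k * x⁻¹)⁻¹ : K) : G) → (χ k * if h : g ∈ H then φ ⟨g, h⟩
        else 0) = F (x * k * x⁻¹) := by
      rintro g rfl
      by_cases h : (((x * k * x⁻¹)⁻¹ : K) : G) ∈ H
      · rw [dif_pos h, ← hχ x k]
        simp only [hF]
        rw [dif_pos h]
      · rw [dif_neg h, mul_zero]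
        simp only [hF]
        rw [dif_neg h]
    exact h2' _ h2.symm
  have h3 : ∀ x : K, ∑ k, F (x * k * x⁻¹) = ∑ k, F k := fun x =>
    Equiv.sum_comp (MulAut.conj x).toEquiv F
  have h4 : ∑ k, F k = ∑ h : H, χ ⟨h, hHK h.2⟩ * φ h⁻¹ := by
    symm
    refine sum_of_injOn (fun h : H => (⟨h, hHK h.2⟩ : K)) ?_ (by simp) ?_ ?_
    · intro h _ h' _ e
      exact Subtype.ext (congrArg (fun k : K => (k : G)) e)
    · intro k _ hk
      rw [hF]
      simp only
      rw [dif_neg]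
      intro h
      apply hk
      refine ⟨⟨k, ?_⟩, by simp, rfl⟩
      simpa using h
    · intro h _
      have : (((⟨h, hHK h.2⟩ : K)⁻¹ : K) : G) ∈ H := by
        simp
      rw [hF]
      simp only
      rw [dif_pos this]
      rfl
  have h5 : ∑ k : K, χ k * ((Fintype.card H : ℂ)⁻¹ * ∑ x : K,
      if h : ((x : G) * ((k⁻¹ : K) : G) * (x : G)⁻¹) ∈ H then φ ⟨_, h⟩ else 0) =
      (Fintype.card H : ℂ)⁻¹ * ((Fintype.card K : ℂ) * ∑ k, F k) := by
    have h6 : ∀ k : K, χ k * ((Fintype.card H : ℂ)⁻¹ * ∑ x : K,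
        if h : ((x : G) * ((k⁻¹ : K) : G) * (x : G)⁻¹) ∈ H then φ ⟨_, h⟩ else 0) =
        (Fintype.card H : ℂ)⁻¹ * ∑ x : K, F (x * k * x⁻¹) := by
      intro k
      rw [mul_left_comm, mul_sum]
      simp only [h1]
    simp only [h6]
    rw [← mul_sum, sum_comm]
    simp only [h3, sum_const, nsmul_eq_mul, card_univ]
  have h7 : (Fintype.card K : ℂ) ≠ 0 := Nat.cast_ne_zero.2 Fintype.card_ne_zero
  rw [h5, ← h4]
  field_simp

theorem fixCount_inv {n : ℕ} (X : Finset (Fin n → Bool)) (σ : Perm (Fin n)) :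
    fixCount X σ⁻¹ = fixCount X σ := by
  unfold fixCount
  congr 1
  ext A
  simp only [mem_filter, and_congr_right_iff]
  intro _
  exact (Equiv.comp_symm_eq σ A A).trans eq_comm

theorem diffChar_inv {n : ℕ} (c : ℕ) (σ : Perm (Fin n)) : diffChar n c σ⁻¹ = diffChar n c σ := by
  simp only [diffChar, fixCount_inv, Perm.sign_inv]

namespace SignedAction

variable {G : Type} [Group G] {n : ℕ} {ω : SignedAction G n} {X : Finset (Fin n → Bool)}

theorem Ample.sum_fixCount_level_mul [Fintype G] (hX : ω.Ample X) (hne : X.Nonempty) {a b : ℕ}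
    (hXb : ∀ A ∈ X, trueCard A = b) (hab : a ≤ b) (hn : a + b ≤ n) :
    ∑ g, fixCount (level n a) (ω.p g) * fixCount X (ω.p g) = (a + 1) * Fintype.card G := by
  classical
  have hfib : ∀ A B : Fin n → Bool,
      #{i | (A i, B i) = (true, true)} + #{i | (A i, B i) = (true, false)} = trueCard A ∧
      #{i | (A i, B i) = (true, true)} + #{i | (A i, B i) = (false, true)} = trueCard B ∧
      #{i | (A i, B i) = (true, true)} + #{i | (A i, B i) = (false, true)} +
        #{i | (A i, B i) = (true, false)} + #{i | (A i, B i) = (false, false)} = n := by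
    intro A B
    simp only [trueCard, card_filter, ← sum_add_distrib]
    refine ⟨sum_congr rfl fun i _ => ?_, sum_congr rfl fun i _ => ?_, ?_⟩
    · cases A i <;> cases B i <;> simp
    · cases A i <;> cases B i <;> simp
    · rw [sum_congr rfl (g := fun _ => 1)]
      · simp
      · intro i _
        cases A i <;> cases B i <;> simp
  have key := sum_card_fixed_eq (G := G)
    (fun g (z : (Fin n → Bool) × (Fin n → Bool)) => (z.1 ∘ ω.p g⁻¹, z.2 ∘ ω.p g⁻¹))
    (by simp) (by
      intro g h z
      simp [Function.comp_assoc, mul_inv_rev]) (level n a ×ˢ X)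
    (by
      intro g z hz
      simp only [mem_product] at hz ⊢
      exact ⟨level_stable a _ _ hz.1, hX.stable _ _ hz.2⟩)
    (fun z => #{i | (z.1 i, z.2 i) = (true, true)}) (by
      intro z hz z' hz'
      simp only [mem_product, level, mem_filter, mem_univ, true_and] at hz hz'
      constructor
      · intro h
        obtain ⟨σ, hσ⟩ := exists_perm_comp_eq (fun i => (z.1 i, z.2 i))
          (fun i => (z'.1 i, z'.2 i)) (by
            have h1 := hfib z.1 z.2
            have h2 := hfib z'.1 z'.2
            have h3 := hXb _ hz.2
            have h4 := hXb _ hz'.2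
            rintro ⟨x, y⟩
            cases x <;> cases y <;> omega)
        have h1 : z'.1 ∘ σ = z.1 := funext fun i => congrArg Prod.fst (congrFun hσ i)
        have h2 : z'.2 ∘ σ = z.2 := funext fun i => congrArg Prod.snd (congrFun hσ i)
        obtain ⟨g, hg, -⟩ := hX.lift σ z'.2 hz'.2 (h2 ▸ hz.2)
        refine ⟨g, ?_⟩
        rw [← h1, ← h2, ← hg]
        ext i <;> simp
      · rintro ⟨g, rfl⟩
        simp only [card_filter]
        exact (Equiv.sum_comp (ω.p g⁻¹)
          (fun i => if (z.1 i, z.2 i) = (true, true) then 1 else 0)).symm)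
  have himage : (level n a ×ˢ X).image (fun z => #{i | (z.1 i, z.2 i) = (true, true)}) =
      range (a + 1) := by
    ext k
    simp only [mem_image, mem_product, mem_range, level, mem_filter, mem_univ, true_and]
    constructor
    · rintro ⟨z, hz, rfl⟩
      have := hfib z.1 z.2
      omega
    · intro hk
      obtain ⟨B, hB⟩ := hne
      have h1 := hfib (fun _ => true) B
      have h2 := hXb B hB
      have h3 : trueCard (fun _ : Fin n => true) = n := by simp [trueCard]
      simp only [Prod.mk.injEq, true_and] at h1
      obtain ⟨S, hS, hSk⟩ := exists_subset_card_eq (s := ({i | B i = true} : Finset (Fin n)))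
        (n := k) (by omega)
      obtain ⟨T, hT, hTk⟩ := exists_subset_card_eq (s := ({i | B i = false} : Finset (Fin n)))
        (n := a - k) (by omega)
      have hSB : ∀ i ∈ S, B i = true := fun i hi => by simpa using hS hi
      have hTB : ∀ i ∈ T, B i = false := fun i hi => by simpa using hT hi
      have hdisj : Disjoint S T := by
        rw [disjoint_left]
        intro i hi hi'
        have := hSB i hi
        rw [hTB i hi'] at this
        cases this
      refine ⟨(fun i => decide (i ∈ S ∪ T), B), ⟨?_, hB⟩, ?_⟩
      · simp only [trueCard, decide_eq_true_eq, filter_mem_eq_inter, univ_inter]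
        rw [card_union_of_disjoint hdisj, hSk, hTk]
        omega
      · rw [← hSk]
        congr 1
        ext i
        simp only [Prod.mk.injEq, decide_eq_true_eq, mem_union, mem_filter, mem_univ, true_and]
        constructor
        · rintro ⟨h | h, h'⟩
          · exact h
          · rw [hTB i h] at h'
            cases h'
        · intro h
          exact ⟨Or.inl h, hSB i h⟩
  rw [himage, card_range] at key
  rw [← key]
  refine sum_congr rfl fun g _ => ?_
  rw [fixCount, fixCount, ← card_product, ← filter_product]
  congr 1
  ext z
  have key : ∀ F : Fin n → Bool, F ∘ ω.p g⁻¹ = F ↔ F ∘ ω.p g = F := by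
    intro F
    rw [map_inv]
    exact (Equiv.comp_symm_eq (ω.p g) F F).trans eq_comm
  simp only [mem_filter, mem_product, Prod.ext_iff, key]

/-- The group contains all the permutations and all the double sign changes. -/
structure Full (ω : SignedAction G n) : Prop where
  lift : ∀ σ : Perm (Fin n), ∃ g, ω.p g = σ ∧ ∀ i, ω.s g i = 1
  signs : ∀ i j, i ≠ j → ∃ g, ω.p g = 1 ∧ ω.s g i = -1 ∧ ω.s g j = -1 ∧
    ∀ k, k ≠ i → k ≠ j → ω.s g k = 1

theorem Full.ample_level (h : ω.Full) (a : ℕ) : ω.Ample (level n a) where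
  stable _ := level_stable a _
  lift σ _ _ _ := h.lift σ
  signs _ _ i j hij _ := h.signs i j hij

theorem mem_level {a : ℕ} {A : Fin n → Bool} : A ∈ level n a ↔ trueCard A = a := by
  simp [level]

theorem level_nonempty {a : ℕ} (h : a ≤ n) : (level n a).Nonempty := by
  obtain ⟨S, -, hS⟩ := exists_subset_card_eq (s := (univ : Finset (Fin n))) (n := a) (by simpa)
  refine ⟨fun i => decide (i ∈ S), mem_level.2 ?_⟩
  simpa only [trueCard, decide_eq_true_eq, filter_mem_eq_inter, univ_inter] using hS

theorem levelPred_zero : levelPred n 0 = ∅ := by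
  simp [levelPred]

theorem levelPred_succ (c : ℕ) : levelPred n (c + 1) = level n c := by
  simp [levelPred, level]

theorem Full.cinner_diffChar (h : ω.Full) [Fintype G] {c : ℕ} (hn : n = 2 * c) :
    cinner (fun g => diffChar n c (ω.p g)) (fun g => diffChar n c (ω.p g)) = 1 := by
  have hG : (Fintype.card G : ℂ) ≠ 0 := Nat.cast_ne_zero.2 Fintype.card_ne_zero
  have h1 := (h.ample_level c).sum_fixCount_level_mul (level_nonempty (by omega))
    (fun A => mem_level.1) le_rfl (by omega)
  have h2 : ∑ g, fixCount (levelPred n c) (ω.p g) * fixCount (level n c) (ω.p g) =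
      c * Fintype.card G := by
    cases c with
    | zero => simp [levelPred_zero, fixCount]
    | succ c =>
      rw [levelPred_succ]
      exact (h.ample_level (c + 1)).sum_fixCount_level_mul (level_nonempty (by omega))
        (fun A => mem_level.1) (by omega) (by omega)
  have h3 : ∑ g, fixCount (levelPred n c) (ω.p g) * fixCount (levelPred n c) (ω.p g) =
      c * Fintype.card G := by
    cases c with
    | zero => simp [levelPred_zero, fixCount]
    | succ c =>
      rw [levelPred_succ]
      exact (h.ample_level c).sum_fixCount_level_mul (level_nonempty (by omega))
        (fun A => mem_level.1) (by omega) (by omega)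
  have h4 : ∑ g, diffChar n c (ω.p g) * diffChar n c (ω.p g⁻¹) =
      ((∑ g, fixCount (level n c) (ω.p g) * fixCount (level n c) (ω.p g) : ℕ) : ℂ) -
      2 * ((∑ g, fixCount (levelPred n c) (ω.p g) * fixCount (level n c) (ω.p g) : ℕ) : ℂ) +
      ((∑ g, fixCount (levelPred n c) (ω.p g) * fixCount (levelPred n c) (ω.p g) : ℕ) : ℂ) := by
    push_cast
    rw [mul_sum, ← sum_sub_distrib, ← sum_add_distrib]
    refine sum_congr rfl fun g _ => ?_
    have hsq : ((Perm.sign (ω.p g) : ℤ) : ℂ) * ((Perm.sign (ω.p g) : ℤ) : ℂ) = 1 := by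
      rw [← Int.cast_mul, ← Units.val_mul, Int.units_mul_self]
      simp
    rw [map_inv, diffChar_inv, diffChar]
    linear_combination ((fixCount (level n c) (ω.p g) : ℂ) - fixCount (levelPred n c) (ω.p g)) ^ 2
      * hsq
  rw [cinner_eq_sum, h4, h1, h2, h3]
  push_cast
  field_simp
  ring

theorem Ample.cinner_diffChar_sign [Fintype G] (hX : ω.Ample X) (hX1 : #X = 1) {c : ℕ}
    (hn : n = 2 * c) (hXc : ∀ A ∈ X, trueCard A = c) :
    cinner (fun g => diffChar n c (ω.p g)) (fun g => ((Perm.sign (ω.p g) : ℤ) : ℂ)) = 1 := by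
  have hG : (Fintype.card G : ℂ) ≠ 0 := Nat.cast_ne_zero.2 Fintype.card_ne_zero
  obtain ⟨A, rfl⟩ := card_eq_one.1 hX1
  have hfix : ∀ g, fixCount {A} (ω.p g) = 1 := by
    intro g
    have := hX.stable g A (by simp)
    rw [fixCount, filter_singleton, if_pos (by simpa using this), card_singleton]
  have h1 := hX.sum_fixCount_level_mul (by simp) hXc le_rfl (by omega)
  have h2 : ∑ g, fixCount (levelPred n c) (ω.p g) * fixCount {A} (ω.p g) =
      c * Fintype.card G := by
    cases c with
    | zero => simp [levelPred_zero, fixCount]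
    | succ c =>
      rw [levelPred_succ]
      exact hX.sum_fixCount_level_mul (by simp) hXc (by omega) (by omega)
  simp only [hfix, mul_one] at h1 h2
  have h4 : ∑ g, diffChar n c (ω.p g) * ((Perm.sign (ω.p g⁻¹) : ℤ) : ℂ) =
      ((∑ g, fixCount (level n c) (ω.p g) : ℕ) : ℂ) -
      ((∑ g, fixCount (levelPred n c) (ω.p g) : ℕ) : ℂ) := by
    push_cast
    rw [← sum_sub_distrib]
    refine sum_congr rfl fun g _ => ?_
    have hsq : ((Perm.sign (ω.p g) : ℤ) : ℂ) * ((Perm.sign (ω.p g) : ℤ) : ℂ) = 1 := by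
      rw [← Int.cast_mul, ← Units.val_mul, Int.units_mul_self]
      simp
    rw [map_inv, Perm.sign_inv, diffChar]
    linear_combination ((fixCount (level n c) (ω.p g) : ℂ) - fixCount (levelPred n c) (ω.p g))
      * hsq
  rw [cinner_eq_sum, h4, h1, h2]
  push_cast
  field_simp
  ring

theorem bMult_sub [Fintype G] (X Y : Finset (Fin n → Bool)) (d : ℕ) :
    bMult ω.char (fun g => ((Perm.sign (ω.p g) : ℤ) : ℂ) *
      ((fixCount X (ω.p g) : ℂ) - fixCount Y (ω.p g))) d =
      (Fintype.card G : ℂ)⁻¹ * (ω.twistedSum X d - ω.twistedSum Y d) := by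
  rw [bMult, cinner_eq_sum, twistedSum, twistedSum, ← sum_sub_distrib]
  congr 1
  refine Fintype.sum_equiv (Equiv.inv G) _ _ fun g => ?_
  rw [symChar_char, Equiv.inv_apply, map_inv, fixCount_inv, fixCount_inv, Perm.sign_inv]
  ring

theorem twistedSum_empty [Fintype G] (d : ℕ) : ω.twistedSum ∅ d = 0 := by
  simp [twistedSum, fixCount]

theorem Ample.bMult_sign [Fintype G] (hX : ω.Ample X) (hX1 : #X = 1) (d : ℕ) :
    bMult ω.char (fun g => ((Perm.sign (ω.p g) : ℤ) : ℂ)) d =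
      (Fintype.card G : ℂ)⁻¹ * ω.twistedSum X d := by
  obtain ⟨A, rfl⟩ := card_eq_one.1 hX1
  have hfix : ∀ g, fixCount {A} (ω.p g) = 1 := by
    intro g
    have := hX.stable g A (by simp)
    rw [fixCount, filter_singleton, if_pos (by simpa using this), card_singleton]
  have h := bMult_sub (ω := ω) {A} ∅ d
  rw [twistedSum_empty, sub_zero] at h
  rw [← h]
  congr 1
  ext g
  rw [hfix]
  simp [fixCount]

theorem Ample.isBAt_sign [Fintype G] (hX : ω.Ample X) (hX1 : #X = 1) {c : ℕ}
    (hn : n = 2 * c) (hXc : ∀ A ∈ X, trueCard A = c) :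
    bMult ω.char (fun g => ((Perm.sign (ω.p g) : ℤ) : ℂ)) (2 * (c * (c - 1))) = 1 ∧
    ∀ d < 2 * (c * (c - 1)), bMult ω.char (fun g => ((Perm.sign (ω.p g) : ℤ) : ℂ)) d = 0 := by
  have hG : (Fintype.card G : ℂ) ≠ 0 := Nat.cast_ne_zero.2 Fintype.card_ne_zero
  constructor
  · rw [hX.bMult_sign hX1, hX.twistedSum_eq_card hn hXc (card_pos.1 (by omega)),
      inv_mul_cancel₀ hG]
  · intro d hd
    rw [hX.bMult_sign hX1, hX.twistedSum_eq_zero (a := c) (b := c) (by omega) hXc (by omega),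
      mul_zero]

theorem Full.twistedSum_levelPred [Fintype G] (h : ω.Full) {c d : ℕ} (hn : n = 2 * c)
    (hd : d ≤ 2 * (c * (c - 1))) : ω.twistedSum (levelPred n c) d = 0 := by
  cases c with
  | zero => rw [levelPred_zero, twistedSum_empty]
  | succ c =>
    rw [levelPred_succ]
    refine (h.ample_level c).twistedSum_eq_zero (a := c) (b := c + 2) (by omega)
      (fun A => mem_level.1) ?_
    refine hd.trans_lt ?_
    cases c with
    | zero => simp
    | succ c =>
      simp only [Nat.add_sub_cancel, show c + 1 + 2 - 1 = c + 2 by omega]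
      nlinarith

theorem Full.isBAt_diffChar [Fintype G] (h : ω.Full) {c : ℕ} (hn : n = 2 * c) :
    bMult ω.char (fun g => diffChar n c (ω.p g)) (2 * (c * (c - 1))) = 1 ∧
    ∀ d < 2 * (c * (c - 1)), bMult ω.char (fun g => diffChar n c (ω.p g)) d = 0 := by
  have hG : (Fintype.card G : ℂ) ≠ 0 := Nat.cast_ne_zero.2 Fintype.card_ne_zero
  constructor
  · refine (bMult_sub _ _ _).trans ?_
    rw [h.twistedSum_levelPred hn le_rfl, (h.ample_level c).twistedSum_eq_card hn
      (fun A => mem_level.1) (level_nonempty (by omega)), sub_zero, inv_mul_cancel₀ hG]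
  · intro d hd
    refine (bMult_sub _ _ _).trans ?_
    rw [h.twistedSum_levelPred hn hd.le, (h.ample_level c).twistedSum_eq_zero (a := c) (b := c)
      (by omega) (fun A => mem_level.1) (by omega), sub_zero, mul_zero]

end SignedAction

/-- The pullback of a signed action along a homomorphism. -/
def SignedAction.comap {G G' : Type} [Group G] [Group G'] {n : ℕ} (ω : SignedAction G n)
    (f : G' →* G) : SignedAction G' n where
  p := ω.p.comp f
  s g := ω.s (f g)
  s_mul g h i := by rw [map_mul, ω.s_mul]; rfl
  s_sq g i := ω.s_sq _ i

/-- The coordinate axis of a signed coordinate vector. -/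
def axis {n : ℕ} : Fin n ⊕ Fin n → Fin n := Sum.elim id id

/-- The sign of a signed coordinate vector. -/
def axisSign {n : ℕ} : Fin n ⊕ Fin n → ℂ := Sum.elim (fun _ => 1) fun _ => -1

section

variable {n : ℕ}

@[simp] theorem axis_inl (i : Fin n) : axis (Sum.inl i) = i := rfl
@[simp] theorem axis_inr (i : Fin n) : axis (Sum.inr i) = i := rfl
@[simp] theorem axisSign_inl (i : Fin n) : axisSign (Sum.inl i) = 1 := rfl
@[simp] theorem axisSign_inr (i : Fin n) : axisSign (Sum.inr i) = -1 := rfl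

@[simp] theorem axis_swap (x : Fin n ⊕ Fin n) : axis x.swap = axis x := by cases x <;> rfl

@[simp] theorem axisSign_swap (x : Fin n ⊕ Fin n) : axisSign x.swap = -axisSign x := by
  cases x <;> simp

theorem axis_axisSign_injective {x y : Fin n ⊕ Fin n} (h : axis x = axis y)
    (h' : axisSign x = axisSign y) : x = y := by
  have h1 : (1 : ℂ) ≠ -1 := by norm_num
  rcases x with i | i <;> rcases y with j | j
  · exact congrArg Sum.inl h
  · exact absurd h' h1
  · exact absurd h' h1.symm
  · exact congrArg Sum.inr h

/-- The group of all signed permutations. -/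
def signed (n : ℕ) : Subgroup (PG n) where
  carrier := {π | ∀ x, π x.swap = (π x).swap}
  mul_mem' {a b} ha hb x := by rw [Perm.mul_apply, hb, ha, Perm.mul_apply]
  one_mem' x := rfl
  inv_mem' {a} ha x := by
    rw [Perm.inv_eq_iff_eq, ha]
    exact congrArg Sum.swap (a.apply_symm_apply x).symm

theorem axis_apply {π : PG n} (hπ : π ∈ signed n) (x : Fin n ⊕ Fin n) :
    axis (π x) = axis (π (Sum.inl (axis x))) := by
  cases x with
  | inl i => rfl
  | inr i => exact (congrArg axis (hπ (Sum.inl i))).trans (axis_swap _)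

theorem axisSign_apply {π : PG n} (hπ : π ∈ signed n) (x : Fin n ⊕ Fin n) :
    axisSign (π x) = axisSign (π (Sum.inl (axis x))) * axisSign x := by
  cases x with
  | inl i => simp
  | inr i => simpa using congrArg axisSign (hπ (Sum.inl i))

/-- The tautological signed action of the group of signed permutations. -/
def signedAction (n : ℕ) : SignedAction (signed n) n where
  p :=
    { toFun := fun π =>
        { toFun := fun i => axis (π.1 (Sum.inl i))
          invFun := fun i => axis (π.1⁻¹ (Sum.inl i))
          left_inv := fun i => by
            exact (axis_apply (inv_mem π.2) _).symm.trans
              (congrArg axis (π.1.symm_apply_apply (Sum.inl i)))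
          right_inv := fun i => by
            exact (axis_apply π.2 _).symm.trans
              (congrArg axis (π.1.apply_symm_apply (Sum.inl i))) }
      map_one' := rfl
      map_mul' := fun π ρ => by
        ext i
        exact congrArg Fin.val (axis_apply π.2 (ρ.1 (Sum.inl i))) }
  s π i := axisSign (π.1 (Sum.inl i))
  s_mul π ρ i := axisSign_apply π.2 (ρ.1 (Sum.inl i))
  s_sq π i := by cases π.1 (Sum.inl i) <;> simp

theorem signedAction_p_apply (π : signed n) (i : Fin n) :
    (signedAction n).p π i = axis (π.1 (Sum.inl i)) := rfl

theorem signedAction_s (π : signed n) (i : Fin n) :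
    (signedAction n).s π i = axisSign (π.1 (Sum.inl i)) := rfl

theorem signedAction_ext {π ρ : signed n} (h : (signedAction n).p π = (signedAction n).p ρ)
    (h' : ∀ i, (signedAction n).s π i = (signedAction n).s ρ i) : π = ρ := by
  refine Subtype.ext (Equiv.ext fun x => ?_)
  refine axis_axisSign_injective ?_ ?_
  · rw [axis_apply π.2, axis_apply ρ.2]
    exact congrArg (fun σ : Perm (Fin n) => σ (axis x)) h
  · rw [axisSign_apply π.2, axisSign_apply ρ.2]
    exact congrArg (· * axisSign x) (h' _)

theorem reflChar_eq (π : signed n) : reflChar π.1 = (signedAction n).char π := by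
  rw [reflChar, Matrix.trace, SignedAction.char]
  refine sum_congr rfl fun i _ => ?_
  rw [signedAction_p_apply, signedAction_s, Matrix.diag, Mrefl, Matrix.of_apply]
  rcases π.1 (Sum.inl i) with j | j <;> by_cases h : j = i <;> simp [h]

theorem sgnChar_eq (π : signed n) : sgnChar π.1 =
    (∏ i, (signedAction n).s π i) * ((Perm.sign ((signedAction n).p π) : ℤ) : ℂ) := by
  have h := Matrix.det_permutation (R := ℂ) ((signedAction n).p π)
  rw [← h, ← Matrix.det_mul_column, ← Matrix.det_transpose, sgnChar]
  congr 1
  ext i j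
  rw [Matrix.transpose_apply, Matrix.of_apply, Mrefl, Matrix.of_apply, Equiv.Perm.permMatrix,
    PEquiv.toMatrix_apply, toPEquiv_apply, signedAction_p_apply, signedAction_s]
  rcases π.1 (Sum.inl j) with k | k <;> by_cases h : k = i <;> simp [h]

theorem sumCongr_mem_signed (σ : Perm (Fin n)) : Perm.sumCongr σ σ ∈ signed n := by
  rintro (i | i) <;> rfl

theorem sumCongr_swap (i j : Fin n) : Perm.sumCongr (swap i j) (swap i j) = dsw i j := by
  rw [dsw, ← Perm.sumCongr_swap_one, ← Perm.sumCongr_one_swap, Perm.sumCongr_mul, mul_one, one_mul]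

theorem dsw_mem_signed (i j : Fin n) : dsw i j ∈ signed n :=
  sumCongr_swap i j ▸ sumCongr_mem_signed _

theorem ssw_inl (i j : Fin n) : ssw i (Sum.inl j) = if j = i then Sum.inr j else Sum.inl j := by
  rw [ssw, swap_apply_def]
  split_ifs <;> simp_all

theorem ssw_inr (i j : Fin n) : ssw i (Sum.inr j) = if j = i then Sum.inl j else Sum.inr j := by
  rw [ssw, swap_apply_def]
  split_ifs <;> simp_all

theorem ssw_mem_signed (i : Fin n) : ssw i ∈ signed n := by
  rintro (j | j) <;> simp only [Sum.swap_inl, Sum.swap_inr, ssw_inl, ssw_inr] <;> split_ifs <;> rfl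

theorem msw_eq {i j : Fin n} (h : i ≠ j) : msw i j = dsw i j * (ssw i * ssw j) := by
  ext x
  rcases x with k | k <;>
  simp only [msw, dsw, Perm.mul_apply, ssw_inl, ssw_inr, swap_apply_def] <;>
  by_cases h1 : k = i <;> by_cases h2 : k = j <;> simp_all [ssw_inl, ssw_inr, Ne.symm h]

theorem msw_self (i : Fin n) : msw i i = 1 := by
  rw [msw, swap_comm, swap_mul_self]

end

section

variable {n : ℕ}

/-- The signed permutation permuting the coordinate vectors. -/
def lift (n : ℕ) : Perm (Fin n) →* signed n where
  toFun σ := ⟨Perm.sumCongr σ σ, sumCongr_mem_signed σ⟩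
  map_one' := Subtype.ext (Perm.sumCongr_one)
  map_mul' σ τ := Subtype.ext (Perm.sumCongr_mul σ σ τ τ).symm

theorem p_lift (σ : Perm (Fin n)) : (signedAction n).p (lift n σ) = σ := rfl

theorem s_lift (σ : Perm (Fin n)) (i : Fin n) : (signedAction n).s (lift n σ) i = 1 := rfl

theorem dsw_eq (i j : Fin n) : (⟨dsw i j, dsw_mem_signed i j⟩ : signed n) = lift n (swap i j) :=
  Subtype.ext (sumCongr_swap i j).symm

/-- The sign change of a coordinate. -/
def signChange (i : Fin n) : signed n := ⟨ssw i, ssw_mem_signed i⟩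

theorem p_signChange (i : Fin n) : (signedAction n).p (signChange i) = 1 := by
  ext j
  rw [signedAction_p_apply, signChange, ssw_inl]
  split_ifs <;> rfl

theorem s_signChange (i j : Fin n) :
    (signedAction n).s (signChange i) j = if j = i then -1 else 1 := by
  rw [signedAction_s, signChange, ssw_inl]
  split_ifs <;> rfl

/-- The product of the signs of a signed permutation. -/
def prodSign (n : ℕ) : signed n →* ℂ where
  toFun π := ∏ i, (signedAction n).s π i
  map_one' := prod_eq_one fun i _ => SignedAction.s_one _ i
  map_mul' π ρ := by
    simp only [SignedAction.s_mul, prod_mul_distrib]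
    congr 1
    exact Equiv.prod_comp ((signedAction n).p ρ) fun i => (signedAction n).s π i

theorem prodSign_lift (σ : Perm (Fin n)) : prodSign n (lift n σ) = 1 :=
  show ∏ i, (signedAction n).s (lift n σ) i = 1 from prod_eq_one fun i _ => s_lift σ i

theorem prodSign_signChange (i : Fin n) : prodSign n (signChange i) = -1 := by
  change ∏ j, (signedAction n).s (signChange i) j = -1
  simp only [s_signChange, prod_ite_eq', mem_univ, if_true]

theorem msw_eq_signed {i j : Fin n} (h : i ≠ j) :
    msw i j = (lift n (swap i j) * (signChange i * signChange j) : signed n) := by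
  rw [msw_eq h, ← dsw_eq]
  rfl

/-- The permutations preserving the blocks of `f`. -/
def blockStab (f : Fin n → ℕ) : Subgroup (Perm (Fin n)) where
  carrier := {σ | f ∘ σ = f}
  mul_mem' {a b} ha hb := by
    change f ∘ (a ∘ b) = f
    rw [← Function.comp_assoc, ha, hb]
  one_mem' := rfl
  inv_mem' {a} ha := ((Equiv.comp_symm_eq a f f).2 ha.symm)

theorem swap_mem_blockStab {f : Fin n → ℕ} {i j : Fin n} (h : f i = f j) :
    swap i j ∈ blockStab f := by
  change f ∘ swap i j = f
  rw [comp_swap_eq_update, h, Function.update_eq_self, ← h, Function.update_eq_self]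

theorem blockStab_le_closure (f : Fin n → ℕ) :
    blockStab f ≤ Subgroup.closure {σ | ∃ i j, i ≠ j ∧ f i = f j ∧ σ = swap i j} := by
  intro σ hσ
  rw [mem_closure_isSwap (by
    rintro _ ⟨i, j, h, -, rfl⟩
    exact ⟨i, j, h, rfl⟩)]
  refine ⟨Set.toFinite _, fun x => ?_⟩
  by_cases h : x = σ x
  · rw [← h]
    exact MulAction.mem_orbit_self x
  · exact ⟨⟨swap x (σ x), Subgroup.subset_closure ⟨x, σ x, h, (congrFun hσ x).symm, rfl⟩⟩,
      swap_apply_left _ _⟩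

theorem lift_mem_blkSub {f : Fin n → ℕ} (ty : Fin n → BTy) {σ : Perm (Fin n)}
    (hσ : f ∘ σ = f) : (lift n σ : PG n) ∈ blkSub n f ty := by
  have : Subgroup.closure {σ | ∃ i j, i ≠ j ∧ f i = f j ∧ σ = swap i j} ≤
      (blkSub n f ty).comap ((signed n).subtype.comp (lift n)) := by
    rw [Subgroup.closure_le]
    rintro _ ⟨i, j, -, h, rfl⟩
    change (lift n (swap i j) : PG n) ∈ blkSub n f ty
    rw [← dsw_eq]
    exact Subgroup.subset_closure (Or.inl (Or.inl ⟨i, j, h, rfl⟩))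
  exact this (blockStab_le_closure f hσ)

theorem blkSub_le {f : Fin n → ℕ} {ty : Fin n → BTy} {K : Subgroup (signed n)}
    (h1 : ∀ i j, f i = f j → lift n (swap i j) ∈ K)
    (h2 : ∀ i, ty i = BTy.B → signChange i ∈ K)
    (h3 : ∀ i j, i ≠ j → f i = f j → ty i = BTy.D → ty j = BTy.D →
      signChange i * signChange j ∈ K) :
    blkSub n f ty ≤ K.map (signed n).subtype := by
  rw [blkSub, Subgroup.closure_le]
  rintro π ((⟨i, j, h, rfl⟩ | ⟨i, h, rfl⟩) | ⟨i, j, h, hi, hj, rfl⟩)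
  · exact ⟨lift n (swap i j), h1 i j h, sumCongr_swap i j⟩
  · exact ⟨signChange i, h2 i h, rfl⟩
  · rcases eq_or_ne i j with rfl | hij
    · rw [msw_self]
      exact one_mem _
    · exact ⟨_, K.mul_mem (h1 i j h) (h3 i j hij h hi hj), (msw_eq_signed hij).symm⟩

theorem blkSub_le_signed (f : Fin n → ℕ) (ty : Fin n → BTy) : blkSub n f ty ≤ signed n := by
  refine (blkSub_le (K := ⊤) ?_ ?_ ?_).trans ?_
  · exact fun _ _ _ => trivial
  · exact fun _ _ => trivial
  · exact fun _ _ _ _ _ _ => trivial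
  · rintro _ ⟨π, -, rfl⟩
    exact π.2

theorem comp_p_of_mem_blkSub {f : Fin n → ℕ} {ty : Fin n → BTy} {π : signed n}
    (h : (π : PG n) ∈ blkSub n f ty) : f ∘ (signedAction n).p π = f := by
  have : blkSub n f ty ≤ ((blockStab f).comap (signedAction n).p).map (signed n).subtype := by
    refine blkSub_le ?_ ?_ ?_
    · exact fun i j hij => swap_mem_blockStab hij
    · intro i _
      rw [Subgroup.mem_comap, p_signChange]
      exact one_mem _
    · intro i j _ _ _ _
      rw [Subgroup.mem_comap, map_mul, p_signChange, p_signChange]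
      exact one_mem _
  obtain ⟨ρ, hρ, hρπ⟩ := this h
  obtain rfl : ρ = π := Subtype.ext hρπ
  exact hρ

theorem prodSign_of_mem_blkSub {f : Fin n → ℕ} {π : signed n}
    (h : (π : PG n) ∈ blkSub n f fun _ => BTy.D) : prodSign n π = 1 := by
  have : (blkSub n f fun _ => BTy.D) ≤ (prodSign n).ker.map (signed n).subtype := by
    refine blkSub_le ?_ ?_ ?_
    · exact fun i j _ => prodSign_lift _
    · rintro _ ⟨⟩
    · intro i j _ _ _ _
      rw [MonoidHom.mem_ker, map_mul, prodSign_signChange, prodSign_signChange]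
      norm_num
  obtain ⟨ρ, hρ, hρπ⟩ := this h
  obtain rfl : ρ = π := Subtype.ext hρπ
  exact hρ

theorem mem_blkSub_B {f : Fin n → ℕ} {π : signed n} :
    (π : PG n) ∈ (blkSub n f fun _ => BTy.B) ↔ f ∘ (signedAction n).p π = f := by
  refine ⟨comp_p_of_mem_blkSub, fun h => ?_⟩
  have key : ∀ S : Finset (Fin n), ∀ ρ : signed n, (signedAction n).p ρ = 1 →
      (∀ i ∉ S, (signedAction n).s ρ i = 1) → (ρ : PG n) ∈ blkSub n f fun _ => BTy.B := by
    intro S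
    induction S using Finset.induction with
    | empty =>
      intro ρ h1 h2
      have : ρ = 1 := signedAction_ext (by rw [h1, map_one]) fun i => by
        rw [h2 i (by simp), SignedAction.s_one]
      rw [this]
      exact one_mem _
    | insert a S ha ih =>
      intro ρ h1 h2
      by_cases hs : (signedAction n).s ρ a = 1
      · refine ih ρ h1 fun i hi => ?_
        by_cases hia : i = a
        · rw [hia, hs]
        · exact h2 i (by simp [hia, hi])
      · have hs' : (signedAction n).s ρ a = -1 :=
          (mul_self_eq_one_iff.1 ((signedAction n).s_sq ρ a)).resolve_left hs
        have h3 : ((signChange a * ρ : signed n) : PG n) ∈ blkSub n f fun _ => BTy.B := by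
          refine ih _ (by rw [map_mul, p_signChange, h1, one_mul]) fun i hi => ?_
          rw [SignedAction.s_mul, h1, Perm.one_apply, s_signChange]
          by_cases hia : i = a
          · rw [if_pos hia, hia, hs']
            norm_num
          · rw [if_neg hia, h2 i (by simp [hia, hi]), one_mul]
        have h4 : (signChange a : PG n) ∈ blkSub n f fun _ => BTy.B :=
          Subgroup.subset_closure (Or.inl (Or.inr ⟨a, rfl, rfl⟩))
        exact ((blkSub n f fun _ => BTy.B).mul_mem_cancel_left h4).1 h3
  have h1 : (lift n ((signedAction n).p π) : PG n) ∈ blkSub n f fun _ => BTy.B :=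
    lift_mem_blkSub _ h
  have h2 : (((lift n ((signedAction n).p π))⁻¹ * π : signed n) : PG n) ∈
      blkSub n f fun _ => BTy.B := by
    refine key univ _ ?_ (by simp)
    rw [map_mul, map_inv, p_lift, inv_mul_cancel]
  have h3 := (blkSub n f fun _ => BTy.B).mul_mem h1 h2
  rwa [← Subgroup.coe_mul, mul_inv_cancel_left] at h3

theorem signChange_mul_mem_blkSub {f : Fin n → ℕ} {i j : Fin n} (hij : i ≠ j) (h : f i = f j) :
    ((signChange i * signChange j : signed n) : PG n) ∈ blkSub n f fun _ => BTy.D := by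
  have h1 : msw i j ∈ blkSub n f fun _ => BTy.D :=
    Subgroup.subset_closure (Or.inr ⟨i, j, h, rfl, rfl, rfl⟩)
  have h2 : (lift n (swap i j) : PG n) ∈ blkSub n f fun _ => BTy.D :=
    lift_mem_blkSub _ (swap_mem_blockStab h)
  rw [msw_eq_signed hij, Subgroup.coe_mul] at h1
  exact (Subgroup.mul_mem_cancel_left _ h2).1 h1

theorem s_signChange_mul {i j : Fin n} (hij : i ≠ j) :
    (signedAction n).p (signChange i * signChange j) = 1 ∧
    (signedAction n).s (signChange i * signChange j) i = -1 ∧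
    (signedAction n).s (signChange i * signChange j) j = -1 ∧
    ∀ k, k ≠ i → k ≠ j → (signedAction n).s (signChange i * signChange j) k = 1 := by
  simp only [SignedAction.s_mul, map_mul, p_signChange, s_signChange, Perm.one_apply, mul_one]
  refine ⟨trivial, ?_, ?_, ?_⟩
  · simp [hij]
  · simp [hij.symm]
  · intro k h1 h2
    simp [h1, h2]

/-- The signed action of a reflection subgroup. -/
def blkAction (f : Fin n → ℕ) (ty : Fin n → BTy) : SignedAction (blkSub n f ty) n :=
  (signedAction n).comap (Subgroup.inclusion (blkSub_le_signed f ty))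

theorem resChar_reflChar (f : Fin n → ℕ) (ty : Fin n → BTy) :
    resChar (blkSub n f ty) reflChar = (blkAction f ty).char :=
  funext fun π => reflChar_eq (Subgroup.inclusion (blkSub_le_signed f ty) π)

theorem resChar_sgnChar (f : Fin n → ℕ) :
    resChar (blkSub n f fun _ => BTy.D) sgnChar =
      fun π => ((Perm.sign ((blkAction f fun _ => BTy.D).p π) : ℤ) : ℂ) := by
  funext π
  refine (sgnChar_eq (Subgroup.inclusion (blkSub_le_signed f _) π)).trans ?_
  have h := prodSign_of_mem_blkSub (f := f)
    (π := Subgroup.inclusion (blkSub_le_signed f _) π) π.2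
  exact (congrArg (· * _) h).trans (one_mul _)

theorem full_blkAction : (blkAction (n := n) (fun _ => 0) fun _ => BTy.D).Full where
  lift σ := ⟨⟨lift n σ, lift_mem_blkSub _ rfl⟩, rfl, fun _ => rfl⟩
  signs _ _ hij := ⟨⟨_, signChange_mul_mem_blkSub hij rfl⟩, s_signChange_mul hij⟩

theorem ample_blkAction {f : Fin n → ℕ} {A : Fin n → Bool}
    (hA : ∀ i j, A i = A j ↔ f i = f j) :
    (blkAction f fun _ => BTy.D).Ample {A} where
  stable g B hB := by
    rw [mem_singleton] at hB ⊢
    subst hB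
    have h := comp_p_of_mem_blkSub (f := f)
      (π := Subgroup.inclusion (blkSub_le_signed f _) g) g.2
    funext i
    exact (hA _ _).2 (congrFun h i)
  lift σ B hB hB' := by
    rw [mem_singleton] at hB hB'
    subst hB
    have h : f ∘ σ = f := funext fun i => (hA _ _).1 (congrFun hB' i)
    exact ⟨⟨lift n σ, lift_mem_blkSub _ h⟩, rfl, fun _ => rfl⟩
  signs B hB i j hij hBij := by
    rw [mem_singleton] at hB
    subst hB
    exact ⟨⟨_, signChange_mul_mem_blkSub hij ((hA _ _).1 hBij)⟩, s_signChange_mul hij⟩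

end

section

variable {n : ℕ}

theorem BWn_le_signed (n : ℕ) : BWn n ≤ signed n := blkSub_le_signed _ _

theorem mem_BWn (π : signed n) : (π : PG n) ∈ BWn n := mem_blkSub_B.2 rfl

/-- The permutation underlying an element of the hyperoctahedral group. -/
def permB (n : ℕ) : BWn n →* Perm (Fin n) :=
  (signedAction n).p.comp (Subgroup.inclusion (BWn_le_signed n))

theorem mem_blkSub_B_iff {f : Fin n → ℕ} (x : BWn n) :
    (x : PG n) ∈ (blkSub n f fun _ => BTy.B) ↔ f ∘ permB n x = f :=
  mem_blkSub_B (π := Subgroup.inclusion (BWn_le_signed n) x)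

theorem blkSub_B_le_BWn (f : Fin n → ℕ) : (blkSub n f fun _ => BTy.B) ≤ BWn n := fun π h =>
  mem_BWn ⟨π, blkSub_le_signed _ _ h⟩

theorem indChar_blkSub_B {c : ℕ} (F : Fin n → Fin c) {f : Fin n → ℕ} (hf : ∀ i, f i = F i)
    {φ : (blkSub n f fun _ => BTy.B) → ℂ} (hφ : ∀ h, φ h = 1) (w : BWn n) :
    indChar (blkSub n f fun _ => BTy.B) (BWn n) φ w =
      (#{g : Fin n → Fin c | g ∘ permB n w = g ∧
        ∀ b, #{i | g i = b} = #{i | F i = b}} : ℂ) := by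
  classical
  have := Fintype.ofFinite (BWn n)
  have := Fintype.ofFinite (blkSub n f fun _ => BTy.B)
  have hfF : ∀ σ τ : Perm (Fin n), f ∘ σ = f ∘ τ ↔ F ∘ σ = F ∘ τ := by
    intro σ τ
    simp only [funext_iff, Function.comp_apply, hf, Fin.val_inj]
  have h1 : ∀ x : BWn n, (x : PG n) * w * (x : PG n)⁻¹ ∈ (blkSub n f fun _ => BTy.B) ↔
      (F ∘ permB n x) ∘ permB n w = F ∘ permB n x := by
    intro x
    have h2 := mem_blkSub_B_iff (f := f) (x * w * x⁻¹)
    rw [map_mul, map_mul, map_inv] at h2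
    refine h2.trans ?_
    have h3 := hfF (permB n x * permB n w) (permB n x)
    refine Iff.trans ?_ h3
    exact Equiv.comp_symm_eq (permB n x) f (f ∘ (permB n x * permB n w : Perm (Fin n)))
  set S : Finset (Fin n → Fin c) := {g : Fin n → Fin c | g ∘ permB n w = g ∧
        ∀ b, #{i | g i = b} = #{i | F i = b}} with hS
  have hcount : #{x : BWn n | (F ∘ permB n x) ∘ permB n w = F ∘ permB n x} =
      #S * Fintype.card (blkSub n f fun _ => BTy.B) := by
    rw [card_eq_sum_card_fiberwise (f := fun x : BWn n => F ∘ permB n x) (t := S)]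
    · rw [sum_const_nat]
      intro g hg
      rw [hS, mem_filter] at hg
      obtain ⟨σ, hσ⟩ := exists_perm_comp_eq g F hg.2.2
      obtain ⟨x₀, hx₀⟩ : ∃ x : BWn n, permB n x = σ := ⟨⟨lift n σ, mem_BWn _⟩, rfl⟩
      symm
      rw [← card_univ]
      refine card_bij (fun h _ => (⟨h, blkSub_B_le_BWn f h.2⟩ : BWn n) * x₀) ?_ ?_ ?_
      · intro h _
        have h2 : F ∘ permB n ⟨h, blkSub_B_le_BWn f h.2⟩ = F :=
          (hfF _ 1).1 ((mem_blkSub_B_iff (⟨h, blkSub_B_le_BWn f h.2⟩ : BWn n)).1 h.2)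
        have h3 : F ∘ permB n (⟨h, blkSub_B_le_BWn f h.2⟩ * x₀) = g := by
          rw [map_mul, Perm.coe_mul, ← Function.comp_assoc, h2, hx₀, hσ]
        rw [mem_filter, mem_filter, h3]
        exact ⟨⟨mem_univ _, hg.2.1⟩, rfl⟩
      · intro h _ h' _ e
        exact Subtype.ext (congrArg (fun k : BWn n => (k : PG n)) (mul_right_cancel e))
      · intro x hx
        rw [mem_filter] at hx
        have h2 : ((x * x₀⁻¹ : BWn n) : PG n) ∈ blkSub n f fun _ => BTy.B := by
          rw [mem_blkSub_B_iff, map_mul, map_inv, hx₀]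
          refine (Equiv.comp_symm_eq σ f (f ∘ permB n x)).2 ?_
          rw [hfF, hσ, hx.2]
        exact ⟨⟨_, h2⟩, mem_univ _, inv_mul_cancel_right x x₀⟩
    · intro x hx
      rw [mem_coe, mem_filter] at hx
      rw [hS, mem_coe, mem_filter]
      refine ⟨mem_univ _, hx.2, fun b => ?_⟩
      simp only [card_filter]
      exact Equiv.sum_comp (permB n x) fun i => if F i = b then 1 else 0
  have hH : (Fintype.card (blkSub n f fun _ => BTy.B) : ℂ) ≠ 0 :=
    Nat.cast_ne_zero.2 Fintype.card_ne_zero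
  simp only [indChar, finsum_eq_sum_of_fintype, Nat.card_eq_fintype_card, hφ, dite_eq_ite, h1]
  rw [sum_boole, hcount, Nat.cast_mul]
  field_simp

theorem blockOf_eq {N : ℕ} {s : ℕ → ℕ} {i b : ℕ} (hb : b < N) (h1 : ∑ k ∈ range b, s k ≤ i)
    (h2 : i < ∑ k ∈ range (b + 1), s k) : blockOf N s i = b := by
  have hmono : ∀ {k l : ℕ}, k ≤ l → ∑ j ∈ range k, s j ≤ ∑ j ∈ range l, s j := fun h =>
    sum_le_sum_of_subset (range_subset_range.2 h)
  rw [blockOf, ← card_range b]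
  congr 1
  ext k
  rw [mem_filter, mem_range, mem_range]
  constructor
  · rintro ⟨-, hk⟩
    by_contra h
    have := hmono (show b + 1 ≤ k + 1 by omega)
    omega
  · intro hk
    exact ⟨by omega, (hmono (show k + 1 ≤ b by omega)).trans h1⟩

theorem exists_block {N : ℕ} {s : ℕ → ℕ} {i : ℕ} (h : i < ∑ k ∈ range N, s k) :
    ∃ b < N, ∑ k ∈ range b, s k ≤ i ∧ i < ∑ k ∈ range (b + 1), s k := by
  induction N with
  | zero => simp at h
  | succ N ih =>
    by_cases h' : i < ∑ k ∈ range N, s k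
    · obtain ⟨b, hb, h⟩ := ih h'
      exact ⟨b, by omega, h⟩
    · exact ⟨N, by omega, by omega, h⟩

theorem blockOf_lt {N : ℕ} {s : ℕ → ℕ} {i : ℕ} (h : i < ∑ k ∈ range N, s k) :
    blockOf N s i < N := by
  obtain ⟨b, hb, h1, h2⟩ := exists_block h
  rwa [blockOf_eq hb h1 h2]

theorem card_blockOf {N : ℕ} {s : ℕ → ℕ} (hn : ∑ k ∈ range N, s k = n) {b : ℕ} (hb : b < N) :
    #{i : Fin n | blockOf N s i = b} = s b := by
  have h1 : #(Ico (∑ k ∈ range b, s k) (∑ k ∈ range (b + 1), s k)) = s b := by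
    rw [Nat.card_Ico, sum_range_succ, Nat.add_sub_cancel_left]
  rw [← h1]
  refine card_bij (fun i _ => (i : ℕ)) ?_ (fun i _ j _ => Fin.ext) ?_
  · intro i hi
    obtain ⟨b', hb', h1, h2⟩ := exists_block (hn.symm ▸ i.2 : (i : ℕ) < ∑ k ∈ range N, s k)
    rw [mem_filter, blockOf_eq hb' h1 h2] at hi
    rw [mem_Ico, ← hi.2]
    exact ⟨h1, h2⟩
  · intro i hi
    rw [mem_Ico] at hi
    have : ∑ k ∈ range (b + 1), s k ≤ ∑ k ∈ range N, s k :=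
      sum_le_sum_of_subset (range_subset_range.2 hb)
    refine ⟨⟨i, by omega⟩, ?_, rfl⟩
    rw [mem_filter]
    exact ⟨mem_univ _, blockOf_eq hb hi.1 hi.2⟩

theorem indPiece_eq_zero {r s : ℕ} {a : Fin r → ℤ} {d : Fin s → ℤ} (h : ∃ j, d j < 0) (w : BWn n) :
    indPiece n r s a d w = 0 := by
  obtain ⟨j, hj⟩ := h
  rw [indPiece, if_neg]
  · rfl
  · rintro ⟨-, h, -⟩
    exact absurd (h j) (by omega)

theorem indPiece_zero_right {c : ℕ} (a : Fin c → ℤ) (w : BWn n) :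
    indPiece n c c a (fun _ => 0) w =
      (#{g : Fin n → Fin c | g ∘ permB n w = g ∧ ∀ b, (#{i | g i = b} : ℤ) = a b} : ℂ) := by
  classical
  by_cases h : (∀ i, 0 ≤ a i) ∧ ∑ i, a i = n
  · obtain ⟨h0, hsum⟩ := h
    rw [indPiece, if_pos ⟨h0, fun _ => le_rfl, by simpa using hsum⟩]
    set s : ℕ → ℕ := fun b => if hb : b < c then (a ⟨b, hb⟩).toNat
      else if hb' : b - c < c then (0 : ℤ).toNat else 0 with hs
    have hs1 : ∀ b : Fin c, s b = (a b).toNat := fun b => by simp [hs]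
    have hs2 : ∀ b, c ≤ b → s b = 0 := fun b hb => by
      simp [hs, Nat.not_lt.2 hb]
    have hsn : ∑ k ∈ range (c + c), s k = n := by
      rw [sum_range_add, sum_eq_zero fun k _ => hs2 _ (Nat.le_add_right c k), add_zero,
        sum_range]
      zify
      rw [← hsum]
      refine sum_congr rfl fun i _ => ?_
      rw [hs1, Int.toNat_of_nonneg (h0 i)]
    have hlt : ∀ i : Fin n, blockOf (c + c) s i < c := by
      intro i
      by_contra hi
      have h1 := blockOf_lt (hsn.symm ▸ i.2 : (i : ℕ) < ∑ k ∈ range (c + c), s k)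
      have h2 := card_blockOf hsn h1
      rw [hs2 _ (Nat.not_lt.1 hi), card_eq_zero] at h2
      exact notMem_empty i (h2 ▸ mem_filter.2 ⟨mem_univ _, rfl⟩)
    refine (indChar_blkSub_B (fun i => ⟨blockOf (c + c) s i, hlt i⟩) (fun _ => rfl) ?_ w).trans ?_
    · intro π
      rw [resChar, epsOn, finprod_eq_one_of_forall_eq_one]
      intro i
      rw [if_neg]
      rintro ⟨hi, -⟩
      exact absurd (hlt i) (Nat.not_lt.2 hi)
    · have hcard : ∀ b : Fin c, (#{i : Fin n | (⟨blockOf (c + c) s i, hlt i⟩ : Fin c) = b} : ℤ) =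
          a b := by
        intro b
        simp only [Fin.ext_iff]
        rw [card_blockOf hsn (by omega), hs1, Int.toNat_of_nonneg (h0 b)]
      simp only [← hcard, Nat.cast_inj]
  · rw [indPiece, if_neg]
    · rw [filter_false_of_mem]
      · simp
      · rintro g - ⟨-, hg⟩
        apply h
        refine ⟨fun i => ?_, ?_⟩
        · rw [← hg]
          positivity
        · simp only [← hg]
          have := card_eq_sum_card_fiberwise (f := g) (s := univ) (t := univ) (by simp)
          rw [card_univ, Fintype.card_fin] at this
          exact_mod_cast this.symm
    · rintro ⟨h1, -, h2⟩
      exact h ⟨h1, by simpa using h2⟩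

theorem exists_lt_of_ne_one {c : ℕ} {τ : Perm (Fin c)} (h : τ ≠ 1) :
    ∃ j : Fin c, (0 : ℤ) - (j : ℕ) + (τ j : ℕ) < 0 := by
  by_contra! hτ
  apply h
  have h1 : ∑ j : Fin c, ((0 : ℤ) - (j : ℕ) + (τ j : ℕ)) = 0 := by
    rw [sum_add_distrib, Equiv.sum_comp τ fun j => ((j : ℕ) : ℤ)]
    simp
  have h2 := (sum_eq_zero_iff_of_nonneg fun j _ => hτ j).1 h1
  ext j
  have := h2 j (mem_univ j)
  rw [Perm.one_apply]
  omega

theorem chiDSymbol_eq {c : ℕ} (hn : n = 2 * c) (w : DWn n) :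
    chiDSymbol n c (fun t => (t : ℕ) + 2) (fun t => (t : ℕ)) w =
      diffChar n c ((blkAction (fun _ => 0) fun _ => BTy.D).p w) := by
  have hw : (w : PG n) ∈ BWn n := mem_BWn ⟨w.1, blkSub_le_signed _ _ w.2⟩
  have h2 : ∀ σ τ : Perm (Fin c), τ ≠ 1 → indPiece n c c
      (fun i => 2 - ((i : ℕ) : ℤ) + (σ i : ℕ)) (fun j => 0 - ((j : ℕ) : ℤ) + (τ j : ℕ))
      ⟨w, hw⟩ = 0 :=
    fun σ τ hτ => indPiece_eq_zero (exists_lt_of_ne_one hτ) _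
  rw [chiDSymbol, resSub, dif_pos hw, chiB]
  simp only [finsum_eq_sum_of_fintype, Nat.cast_add, Nat.cast_ofNat, add_sub_cancel_left, sub_self]
  have h3 : ∀ σ : Perm (Fin c), ∑ τ : Perm (Fin c),
      (((Perm.sign σ : ℤ) * (Perm.sign τ : ℤ) : ℤ) : ℂ) *
      indPiece n c c (fun i => 2 - ((i : ℕ) : ℤ) + (σ i : ℕ))
        (fun j => 0 - ((j : ℕ) : ℤ) + (τ j : ℕ)) ⟨w, hw⟩ =
      (((Perm.sign σ : ℤ) * (#{g : Fin n → Fin c | g ∘ permB n ⟨w, hw⟩ = g ∧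
        ∀ b, (#{i | g i = b} : ℤ) = 2 - (b : ℤ) + (σ b : ℕ)} : ℤ) : ℤ) : ℂ) := by
    intro σ
    rw [sum_eq_single 1 (fun τ _ hτ => by rw [h2 σ τ hτ, mul_zero]) (by simp)]
    have h4 : (fun j : Fin c => (0 : ℤ) - (j : ℕ) + ((1 : Perm (Fin c)) j : ℕ)) = fun _ => 0 := by
      funext j
      simp
    rw [h4, indPiece_zero_right]
    simp
  simp only [h3]
  rw [← Int.cast_sum, sum_sign_mul_card_fixed_colorings n c hn, diffChar]
  push_cast
  rfl

end

theorem IsChar.conj {G : Type} [Group G] {χ : G → ℂ} (h : IsChar χ) (x y : G) :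
    χ (x * y * x⁻¹) = χ y := by
  obtain ⟨V, _, _, ρ, -, hρ⟩ := h
  rw [hρ, hρ, map_mul, LinearMap.trace_mul_comm, ← map_mul, ← mul_assoc, inv_mul_cancel, one_mul]

theorem blkSub_D_le_DWn {n : ℕ} (f : Fin n → ℕ) : (blkSub n f fun _ => BTy.D) ≤ DWn n := by
  refine Subgroup.closure_mono ?_
  rintro π ((⟨i, j, -, rfl⟩ | ⟨i, h, rfl⟩) | ⟨i, j, -, -, -, rfl⟩)
  · exact Or.inl (Or.inl ⟨i, j, rfl, rfl⟩)
  · cases h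
  · exact Or.inr ⟨i, j, rfl, rfl, rfl, rfl⟩

/-- 3.2(c): in the Weyl group `W'_n` of type `D_n` with `n = 2c`,
the `j`-induction of the sign representation from the naturally embedded reflection
subgroup `W'_c × W'_c` equals the irreducible representation with symbol
`[(2 < 3 < … < c+1), (0 < 1 < … < c-1)]`. -/
theorem stmt12 (c n : ℕ) (hn : n = 2 * c) :
    IsJInd (reflChar (n := n))
      (blkSub n (fun i => blockOf 2 (fun _ => c) (i : ℕ)) (fun _ => BTy.D))
      (DWn n) (resChar _ sgnChar)
      (chiDSymbol n c (fun t => (t : ℕ) + 2) (fun t => (t : ℕ))) := by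
  classical
  set f : Fin n → ℕ := fun i => blockOf 2 (fun _ => c) (i : ℕ) with hf
  have hsum : ∑ k ∈ range 2, (fun _ => c) k = n := by simp [hn]
  have hlt : ∀ i, f i < 2 := fun i =>
    blockOf_lt (hsum.symm ▸ i.2 : (i : ℕ) < ∑ k ∈ range 2, (fun _ => c) k)
  set A : Fin n → Bool := fun i => decide (f i = 0) with hA
  have hAf : ∀ i j, A i = A j ↔ f i = f j := by
    intro i j
    have h1 := hlt i
    have h2 := hlt j
    rw [hA]
    simp only [decide_eq_decide]
    omega
  have hAc : ∀ B ∈ ({A} : Finset (Fin n → Bool)), trueCard B = c := by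
    intro B hB
    rw [mem_singleton] at hB
    rw [hB, trueCard]
    simp only [hA, decide_eq_true_eq]
    exact card_blockOf hsum two_pos
  have hH := ample_blkAction hAf
  have hK := full_blkAction (n := n)
  have hchi : chiDSymbol n c (fun t => (t : ℕ) + 2) (fun t => (t : ℕ)) = fun w =>
      diffChar n c ((blkAction (fun _ => 0) fun _ => BTy.D).p w) :=
    funext fun w => chiDSymbol_eq hn w
  have := Fintype.ofFinite (blkSub n f fun _ => BTy.D)
  have := Fintype.ofFinite (blkSub n (fun _ => 0) fun _ => BTy.D)
  have hchar : IsChar (chiDSymbol n c (fun t => (t : ℕ) + 2) (fun t => (t : ℕ))) :=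
    hchi ▸ isChar_diffChar hn _
  obtain ⟨hH1, hH2⟩ := hH.isBAt_sign (card_singleton A) hn hAc
  obtain ⟨hK1, hK2⟩ := hK.isBAt_diffChar hn
  refine ⟨⟨hchar, ?_⟩, ?_, 2 * (c * (c - 1)), ⟨?_, ?_⟩, ?_, ?_, ?_⟩
  · rw [hchi]
    exact hK.cinner_diffChar hn
  · rw [cinner_indChar (blkSub_D_le_DWn f) _ hchar.conj, hchi, resChar_sgnChar]
    have h1 := hH.cinner_diffChar_sign (card_singleton A) hn hAc
    exact ne_of_eq_of_ne h1 one_ne_zero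
  · rw [resChar_reflChar, resChar_sgnChar, hH1]
    exact one_ne_zero
  · rw [resChar_reflChar, resChar_sgnChar]
    exact hH2
  · rw [resChar_reflChar, resChar_sgnChar, hH1]
  · rw [hchi]
    have h1 := resChar_reflChar (n := n) (fun _ => 0) fun _ => BTy.D
    refine ne_of_eq_of_ne ?_ one_ne_zero
    exact (congrArg (fun χ => bMult χ _ _) h1).trans hK1
  · intro d hd
    rw [hchi]
    have h1 := resChar_reflChar (n := n) (fun _ => 0) fun _ => BTy.D
    exact (congrArg (fun χ => bMult χ _ _) h1).trans (hK2 d hd)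

end
end CS
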